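/- arXiv:1302.0207 — 4 statements merged into one kernel-verified Lean document; each statement's English description precedes it below -/
import Mathlib

section
/- Let G be a finite connected simple bipartite graph. Then every cycle of G of length ≥ 6 has a chord if and only if I_G is generated by quadratic binomials. -/
set_option linter.unusedVariables false

open MvPolynomial

universe uv

/-- The monomial `t_a t_b` associated to an edge `{a,b}`. -/
noncomputable def edgeMon {V : Type*} (K : Type*) [Field K] (e : Sym2 V) :
    MvPolynomial V K :=
  Sym2.lift ⟨fun a b => X a * X b, fun _ _ => mul_comm _ _⟩ e

/-- The toric ideal `I_G` of a graph `G`: the kernel of the `K`-algebra map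
`K[x_e : e ∈ E(G)] → K[t_v : v ∈ V]`, `x_e ↦ t_a t_b` for `e = {a,b}`. -/
noncomputable def toricIdeal {V : Type*} (K : Type*) [Field K] (G : SimpleGraph V) :
    Ideal (MvPolynomial G.edgeSet K) :=
  RingHom.ker (MvPolynomial.aeval (R := K) (fun e : G.edgeSet => edgeMon K e.1))

/-- `I` is generated by quadratic binomials (differences of two monic monomials
of degree `2`). -/
def IsQuadBinomialGen {σ K : Type*} [Field K] (I : Ideal (MvPolynomial σ K)) : Prop :=
  ∃ S : Set (MvPolynomial σ K), I = Ideal.span S ∧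
    ∀ f ∈ S, ∃ i j k l : σ, f = X i * X j - X k * X l

/-- `c` describes a cycle of length `q` in `G`: `q ≥ 3`, the vertices
`c 0, …, c (q-1)` are pairwise distinct, and cyclically consecutive vertices
are adjacent. -/
def IsCycleOn' {V : Type*} (G : SimpleGraph V) (q : ℕ) (c : ZMod q → V) : Prop :=
  3 ≤ q ∧ Function.Injective c ∧ ∀ i, G.Adj (c i) (c (i + 1))

/-- The set of edges of the cycle described by `c`. -/
def cycEdges {V : Type*} (q : ℕ) (c : ZMod q → V) : Set (Sym2 V) :=
  { e | ∃ i, e = s(c i, c (i + 1)) }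

/-- The set of vertices of the cycle described by `c`. -/
def cycVerts {V : Type*} (q : ℕ) (c : ZMod q → V) : Set V := Set.range c

/-- `e` is a chord of the cycle `c` in `G`: an edge of `G` joining two vertices of
the cycle which is not an edge of the cycle. -/
def IsChord {V : Type*} (G : SimpleGraph V) (q : ℕ) (c : ZMod q → V) (e : Sym2 V) : Prop :=
  e ∈ G.edgeSet ∧ e ∉ cycEdges q c ∧ ∃ i j : ZMod q, e = s(c i, c j)

namespace ToricGraph

variable {V : Type*} {K : Type*} [Field K] {G : SimpleGraph V}

/-- The exponent vector of the monomial `t_a t_b` of an edge `{a,b}`. -/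
noncomputable def edgeExp (e : Sym2 V) : V →₀ ℕ :=
  Sym2.lift ⟨fun a b => Finsupp.single a 1 + Finsupp.single b 1, fun _ _ => add_comm _ _⟩ e

/-- The degree sequence of a multiset of edges. -/
noncomputable def vertexDeg (G : SimpleGraph V) : (G.edgeSet →₀ ℕ) →ₗ[ℕ] (V →₀ ℕ) :=
  Finsupp.linearCombination ℕ fun e : G.edgeSet => edgeExp e.1

@[simp]
lemma edgeExp_mk (a b : V) :
    edgeExp s(a, b) = Finsupp.single a 1 + Finsupp.single b 1 := rfl

@[simp]
lemma vertexDeg_single (e : G.edgeSet) (k : ℕ) :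
    vertexDeg G (Finsupp.single e k) = k • edgeExp e.1 := by
  simp [vertexDeg]

lemma edgeMon_eq_monomial (e : Sym2 V) : edgeMon K e = monomial (edgeExp e) 1 := by
  induction e with
  | h a b =>
    change (X a * X b : MvPolynomial V K) = _
    simp [X, monomial_mul]

lemma aeval_edgeMon_monomial (u : G.edgeSet →₀ ℕ) (r : K) :
    aeval (R := K) (fun e : G.edgeSet => edgeMon K e.1) (monomial u r) =
      monomial (vertexDeg G u) r := by
  rw [aeval_monomial, vertexDeg, Finsupp.linearCombination_apply, Finsupp.prod, Finsupp.sum,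
    ← mul_one r, ← smul_eq_mul r 1, ← smul_monomial, monomial_sum_one, algebraMap_eq,
    smul_eq_mul, mul_one, smul_eq_C_mul]
  congr 1
  exact Finset.prod_congr rfl fun e _ => by simp [edgeMon_eq_monomial, monomial_pow]

lemma monomial_sub_mem_toricIdeal_iff {u v : G.edgeSet →₀ ℕ} :
    (monomial u 1 - monomial v 1 : MvPolynomial G.edgeSet K) ∈ toricIdeal K G ↔
      vertexDeg G u = vertexDeg G v := by
  rw [toricIdeal, RingHom.mem_ker, map_sub, sub_eq_zero, aeval_edgeMon_monomial,
    aeval_edgeMon_monomial]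
  exact monomial_left_inj one_ne_zero

lemma edgeExp_apply_pos_iff {e : Sym2 V} {w : V} : 0 < edgeExp e w ↔ w ∈ e := by
  classical
  induction e with
  | h a b =>
    simp only [edgeExp_mk, Finsupp.add_apply, Finsupp.single_apply, Sym2.mem_iff]
    split_ifs <;> simp_all [eq_comm]

lemma vertexDeg_apply_pos_iff {u : G.edgeSet →₀ ℕ} {w : V} :
    0 < vertexDeg G u w ↔ ∃ e, u e ≠ 0 ∧ w ∈ e.1 := by
  rw [vertexDeg, Finsupp.linearCombination_apply, Finsupp.sum, Finsupp.finsetSum_apply,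
    Finset.sum_pos_iff]
  simp only [Finsupp.mem_support_iff, Finsupp.smul_apply, smul_eq_mul,
    CanonicallyOrderedAdd.mul_pos, edgeExp_apply_pos_iff]
  exact exists_congr fun e => by grind

lemma degree_vertexDeg (u : G.edgeSet →₀ ℕ) :
    (vertexDeg G u).degree = 2 * u.degree := by
  induction u using Finsupp.induction_linear with
  | zero => simp
  | add u v hu hv => simp only [map_add, hu, hv, mul_add]
  | single e k =>
    obtain ⟨e, he⟩ := e
    induction e with
    | h a b => simp [two_mul]

/-- The ideal generated by the quadratic binomials in the toric ideal. -/
noncomputable def quadIdeal (K : Type*) [Field K] (G : SimpleGraph V) :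
    Ideal (MvPolynomial G.edgeSet K) :=
  Ideal.span {f | f ∈ toricIdeal K G ∧ ∃ i j k l, f = X i * X j - X k * X l}

lemma quadIdeal_le_toricIdeal : quadIdeal K G ≤ toricIdeal K G :=
  Ideal.span_le.2 fun _ hf => hf.1

/-- The toric ideal is spanned by the differences of monomials it contains. -/
lemma toricIdeal_le_of_binomial_mem {J : Ideal (MvPolynomial G.edgeSet K)}
    (hJ : ∀ u v, vertexDeg G u = vertexDeg G v → monomial u 1 - monomial v 1 ∈ J) :
    toricIdeal K G ≤ J := by
  intro f hf
  let L : MvPolynomial V K →ₗ[K] MvPolynomial G.edgeSet K :=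
    (basisMonomials V K).constr K fun w => monomial (Function.invFun (vertexDeg G) w) 1
  have hL (w : V →₀ ℕ) (r : K) :
      L (monomial w r) = C r * monomial (Function.invFun (vertexDeg G) w) 1 := by
    have h := (basisMonomials V K).constr_basis K
      (fun w => (monomial (Function.invFun (vertexDeg G) w) 1 : MvPolynomial G.edgeSet K)) w
    rw [coe_basisMonomials] at h
    rw [← mul_one r, ← smul_eq_mul r 1, ← smul_monomial, map_smul, smul_eq_mul, mul_one,
      ← smul_eq_C_mul]
    exact congrArg (r • ·) h
  have key (g : MvPolynomial G.edgeSet K) :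
      g - L (aeval (R := K) (fun e : G.edgeSet => edgeMon K e.1) g) ∈ J := by
    induction g using MvPolynomial.induction_on' with
    | monomial u r =>
      rw [aeval_edgeMon_monomial, hL, ← mul_one r, ← C_mul_monomial, mul_one, ← mul_sub]
      exact J.mul_mem_left _ (hJ _ _ (Function.invFun_eq ⟨u, rfl⟩).symm)
    | add p q hp hq =>
      rw [map_add, map_add, add_sub_add_comm]
      exact J.add_mem hp hq
  have h0 : aeval (R := K) (fun e : G.edgeSet => edgeMon K e.1) f = 0 := hf
  have hf := key f
  rwa [h0, map_zero, sub_zero] at hf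

open Classical in
/-- The variable of the edge joining `a` and `b`, and `0` if there is no such edge. -/
noncomputable def edgeVar (K : Type*) [Field K] (G : SimpleGraph V) (a b : V) :
    MvPolynomial G.edgeSet K :=
  if h : G.Adj a b then X ⟨s(a, b), h⟩ else 0

lemma edgeVar_of_adj {a b : V} (h : G.Adj a b) :
    edgeVar K G a b = X ⟨s(a, b), h⟩ := dif_pos h

lemma edgeVar_comm (a b : V) : edgeVar K G a b = edgeVar K G b a := by
  by_cases h : G.Adj a b
  · rw [edgeVar_of_adj h, edgeVar_of_adj h.symm]
    congr 2
    exact Sym2.eq_swap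
  · rw [edgeVar, edgeVar, dif_neg h, dif_neg fun h' => h h'.symm]

/-- The binomial of the closed walk `a 0, b 0, a 1, b 1, …, a (n - 1), b (n - 1), a n = a 0`. -/
noncomputable def walkBinomial (K : Type*) [Field K] (G : SimpleGraph V) (n : ℕ) (a b : ℕ → V) :
    MvPolynomial G.edgeSet K :=
  ∏ k ∈ Finset.range n, edgeVar K G (a k) (b k) -
    ∏ k ∈ Finset.range n, edgeVar K G (b k) (a (k + 1))

/-- `a 0, b 0, a 1, b 1, …` is a `2 * n`-periodic walk in `G`. -/
structure IsPeriodicWalk (G : SimpleGraph V) (n : ℕ) (a b : ℕ → V) : Prop where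
  left : Function.Periodic a n
  right : Function.Periodic b n
  adj : ∀ k, G.Adj (a k) (b k)
  adj_succ : ∀ k, G.Adj (b k) (a (k + 1))

/-- Every cycle of length at least `6` has a chord. -/
def LongCyclesHaveChords (G : SimpleGraph V) : Prop :=
  ∀ (q : ℕ) (c : ZMod q → V), IsCycleOn' G q c → 6 ≤ q → ∃ e, IsChord G q c e

lemma walkBinomial_two_mem {a b : ℕ → V} (h : IsPeriodicWalk G 2 a b) :
    walkBinomial K G 2 a b ∈ quadIdeal K G := by
  have h2 : a 2 = a 0 := h.left 0
  have h3 : G.Adj (b 1) (a 0) := h2 ▸ h.adj_succ 1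
  refine Ideal.subset_span ⟨?_, ?_⟩
  · rw [toricIdeal, RingHom.mem_ker]
    simp only [walkBinomial, Finset.prod_range_succ, Finset.prod_range_zero, one_mul, h2, zero_add,
      edgeVar_of_adj (h.adj _), edgeVar_of_adj (h.adj_succ _), map_sub, map_mul,
      aeval_X, Nat.reduceAdd, edgeMon, Sym2.lift_mk]
    ring
  · refine ⟨⟨s(a 0, b 0), h.adj 0⟩, ⟨s(a 1, b 1), h.adj 1⟩, ⟨s(b 0, a 1), h.adj_succ 0⟩,
      ⟨s(b 1, a 0), h3⟩, ?_⟩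
    simp only [walkBinomial, Finset.prod_range_succ, Finset.prod_range_zero, one_mul, h2, zero_add,
      edgeVar_of_adj (h.adj _), edgeVar_of_adj (h.adj_succ _), Nat.reduceAdd]

lemma prod_range_comp_add_of_periodic {M : Type*} [CommMonoid M] {f : ℕ → M} {n : ℕ}
    (hf : Function.Periodic f n) (i : ℕ) :
    ∏ k ∈ Finset.range n, f (i + k) = ∏ k ∈ Finset.range n, f k := by
  induction i with
  | zero => simp
  | succ i ih =>
    rw [← ih]
    cases n with
    | zero => simp
    | succ m =>
      rw [Finset.prod_range_succ, Finset.prod_range_succ' _ m]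
      congr 1
      · exact Finset.prod_congr rfl fun k _ => congrArg f (by ring)
      · rw [add_zero, add_right_comm, add_assoc, hf i]

lemma IsPeriodicWalk.shift {n : ℕ} {a b : ℕ → V} (h : IsPeriodicWalk G n a b) (i : ℕ) :
    IsPeriodicWalk G n (fun k => a (i + k)) fun k => b (i + k) where
  left k := by simp only [← add_assoc, h.left _]
  right k := by simp only [← add_assoc, h.right _]
  adj k := h.adj _
  adj_succ k := h.adj_succ _

lemma IsPeriodicWalk.walkBinomial_shift {n : ℕ} {a b : ℕ → V} (h : IsPeriodicWalk G n a b)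
    (i : ℕ) :
    walkBinomial K G n (fun k => a (i + k)) (fun k => b (i + k)) = walkBinomial K G n a b := by
  unfold walkBinomial
  congr 1
  · exact prod_range_comp_add_of_periodic (f := fun k => edgeVar K G (a k) (b k))
      (fun k => by simp only [h.left k, h.right k]) i
  · exact prod_range_comp_add_of_periodic (f := fun k => edgeVar K G (b k) (a (k + 1)))
      (fun k => by simp only [add_right_comm k n 1, h.left (k + 1), h.right k]) i

/-- A closed walk given on an initial segment extends periodically. -/
lemma walkBinomial_mem_of_closed {J : Ideal (MvPolynomial G.edgeSet K)} {n : ℕ} (hn : 0 < n)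
    (hJ : ∀ a b, IsPeriodicWalk G n a b → walkBinomial K G n a b ∈ J) {a b : ℕ → V}
    (h0 : a n = a 0) (h1 : ∀ k < n, G.Adj (a k) (b k))
    (h2 : ∀ k < n, G.Adj (b k) (a (k + 1))) :
    walkBinomial K G n a b ∈ J := by
  have hmod {k : ℕ} (hk : k < n) : a ((k + 1) % n) = a (k + 1) := by
    obtain hk' | hk' : k + 1 < n ∨ k + 1 = n := by omega
    · rw [Nat.mod_eq_of_lt hk']
    · rw [hk', Nat.mod_self, h0]
  have h := hJ (fun k => a (k % n)) (fun k => b (k % n))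
    { left := fun k => by simp
      right := fun k => by simp
      adj := fun k => h1 _ (Nat.mod_lt _ hn)
      adj_succ := fun k => by
        have := h2 _ (Nat.mod_lt k hn)
        rwa [← hmod (Nat.mod_lt k hn), Nat.mod_add_mod] at this }
  convert h using 1
  unfold walkBinomial
  congr 1
  · refine Finset.prod_congr rfl fun k hk => ?_
    simp only [Nat.mod_eq_of_lt (Finset.mem_range.1 hk)]
  · refine Finset.prod_congr rfl fun k hk => ?_
    simp only [hmod (Finset.mem_range.1 hk), Nat.mod_eq_of_lt (Finset.mem_range.1 hk)]

/-- A chord splits the binomial of a closed walk into those of two shorter closed walks. -/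
lemma walkBinomial_mem_of_chord {J : Ideal (MvPolynomial G.edgeSet K)} {n : ℕ}
    (hJ : ∀ m, 0 < m → m < n → ∀ a b, IsPeriodicWalk G m a b → walkBinomial K G m a b ∈ J)
    {a b : ℕ → V} (h : IsPeriodicWalk G n a b) {j : ℕ} (hj : 0 < j) (hjn : j + 1 < n)
    (hadj : G.Adj (a 0) (b j)) :
    walkBinomial K G n a b ∈ J := by
  obtain ⟨m, rfl⟩ : ∃ m, n = j + (m + 1) := ⟨n - j - 1, by omega⟩
  have hper : a (j + (m + 1)) = a 0 := by simpa using h.left 0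
  have left : walkBinomial K G (j + 1) (fun k => if k ≤ j then a k else a 0) b ∈ J := by
    refine walkBinomial_mem_of_closed (by omega) (hJ (j + 1) (by omega) hjn) (by simp) ?_ ?_
    · intro k hk
      simpa [Nat.lt_succ_iff.1 hk] using h.adj k
    · intro k hk
      split_ifs with hk'
      · exact h.adj_succ k
      · obtain rfl : k = j := by omega
        exact hadj.symm
  have right : walkBinomial K G (m + 1) (fun k => if k = 0 then a 0 else a (j + k))
      (fun k => b (j + k)) ∈ J := by
    refine walkBinomial_mem_of_closed (by omega) (hJ (m + 1) (by omega) (by omega))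
      (by simp [hper]) ?_ ?_
    · intro k hk
      split_ifs with hk'
      · simpa [hk'] using hadj
      · exact h.adj _
    · intro k hk
      simpa [add_assoc] using h.adj_succ (j + k)
  have key : walkBinomial K G (j + (m + 1)) a b =
      (∏ k ∈ Finset.range m, edgeVar K G (a (j + (k + 1))) (b (j + (k + 1)))) *
        walkBinomial K G (j + 1) (fun k => if k ≤ j then a k else a 0) b +
      (∏ k ∈ Finset.range j, edgeVar K G (b k) (a (k + 1))) *
        walkBinomial K G (m + 1) (fun k => if k = 0 then a 0 else a (j + k))
          (fun k => b (j + k)) := by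
    have e1 : ∏ k ∈ Finset.range j, edgeVar K G (if k ≤ j then a k else a 0) (b k) =
        ∏ k ∈ Finset.range j, edgeVar K G (a k) (b k) :=
      Finset.prod_congr rfl fun k hk => by rw [if_pos (Finset.mem_range.1 hk).le]
    have e2 : ∏ k ∈ Finset.range j, edgeVar K G (b k) (if k + 1 ≤ j then a (k + 1) else a 0) =
        ∏ k ∈ Finset.range j, edgeVar K G (b k) (a (k + 1)) :=
      Finset.prod_congr rfl fun k hk => by rw [if_pos (Nat.succ_le_of_lt (Finset.mem_range.1 hk))]
    simp only [walkBinomial]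
    rw [Finset.prod_range_add _ j, Finset.prod_range_add _ j, Finset.prod_range_succ _ j,
      Finset.prod_range_succ _ j, e1, e2, Finset.prod_range_succ' _ m,
      Finset.prod_range_succ' (fun k => edgeVar K G (if k = 0 then a 0 else a (j + k)) _) m]
    simp only [le_refl, if_true, Nat.add_one_ne_zero, if_false, add_zero,
      Nat.not_succ_le_self, ← add_assoc, edgeVar_comm (b j) (a 0)]
    ring
  rw [key]
  exact J.add_mem (J.mul_mem_left _ left) (J.mul_mem_left _ right)

/-- The vertices `a 0, b 0, a 1, b 1, …` in order. -/
def interleave (a b : ℕ → V) (k : ℕ) : V := if k % 2 = 0 then a (k / 2) else b (k / 2)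

lemma interleave_two_mul (a b : ℕ → V) (k : ℕ) : interleave a b (2 * k) = a k := by
  simp [interleave]

lemma interleave_two_mul_add_one (a b : ℕ → V) (k : ℕ) : interleave a b (2 * k + 1) = b k := by
  simp [interleave, Nat.mul_add_div]

lemma IsPeriodicWalk.interleave_periodic {n : ℕ} {a b : ℕ → V} (h : IsPeriodicWalk G n a b) :
    Function.Periodic (interleave a b) (2 * n) := by
  intro k
  obtain ⟨k, rfl | rfl⟩ := Nat.even_or_odd' k
  · rw [← mul_add, interleave_two_mul, interleave_two_mul, h.left]
  · rw [add_right_comm, ← mul_add, interleave_two_mul_add_one, interleave_two_mul_add_one, h.right]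

lemma IsPeriodicWalk.interleave_adj {n : ℕ} {a b : ℕ → V} (h : IsPeriodicWalk G n a b) (k : ℕ) :
    G.Adj (interleave a b k) (interleave a b (k + 1)) := by
  obtain ⟨k, rfl | rfl⟩ := Nat.even_or_odd' k
  · rw [interleave_two_mul, interleave_two_mul_add_one]
    exact h.adj k
  · rw [interleave_two_mul_add_one, show 2 * k + 1 + 1 = 2 * (k + 1) by ring, interleave_two_mul]
    exact h.adj_succ k

/-- If all long cycles have chords, then every periodic walk of long period in a bipartite graph
has a chord joining the two sides. -/
lemma IsPeriodicWalk.exists_chord (hG : LongCyclesHaveChords G) (c : G.Coloring (Fin 2)) {n : ℕ}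
    (hn : 3 ≤ n) {a b : ℕ → V} (h : IsPeriodicWalk G n a b) :
    ∃ p r : ℕ, G.Adj (a p) (b r) ∧ (r : ZMod n) ≠ p ∧ ((r + 1 : ℕ) : ZMod n) ≠ p := by
  have : NeZero n := ⟨by omega⟩
  have two_ne : ((2 : ℕ) : ZMod n) ≠ 0 := by
    rw [Ne, ZMod.natCast_eq_zero_iff]
    exact fun h2 => absurd (Nat.le_of_dvd two_pos h2) (by omega)
  have repeated {i j : ℕ} (hij : (i : ZMod n) ≠ j) (h1 : G.Adj (a i) (b j))
      (h2 : G.Adj (a j) (b i)) :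
      ∃ p r : ℕ, G.Adj (a p) (b r) ∧ (r : ZMod n) ≠ p ∧ ((r + 1 : ℕ) : ZMod n) ≠ p := by
    by_cases h3 : ((j + 1 : ℕ) : ZMod n) = i
    · refine ⟨j, i, h2, hij, fun h4 => two_ne ?_⟩
      push_cast at h3 h4 ⊢
      linear_combination h3 + h4
    · exact ⟨i, j, h1, hij.symm, h3⟩
  have ha (k : ℕ) : c (a k) = c (a 0) := by
    induction k with
    | zero => rfl
    | succ k ih =>
      have := c.valid (h.adj k)
      have := c.valid (h.adj_succ k)
      omega
  have hb (k : ℕ) : c (b k) ≠ c (a 0) := by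
    rw [← ha k]
    exact (c.valid (h.adj k)).symm
  have hab (k l : ℕ) : a k ≠ b l := fun hkl => hb l (hkl ▸ ha k)
  have eq_of_cast {f : ℕ → V} (hf : Function.Periodic f n) {i j : ℕ} (hij : (i : ZMod n) = j) :
      f i = f j := by
    rw [← hf.map_mod_nat i, ← hf.map_mod_nat j, (ZMod.natCast_eq_natCast_iff' _ _ _).1 hij]
  by_cases hai : ∀ i j, a i = a j → (i : ZMod n) = j
  swap
  · push Not at hai
    obtain ⟨i, j, hij, hne⟩ := hai
    exact repeated hne (hij ▸ h.adj j) (hij ▸ h.adj i)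
  by_cases hbi : ∀ i j, b i = b j → (i : ZMod n) = j
  swap
  · push Not at hbi
    obtain ⟨i, j, hij, hne⟩ := hbi
    exact repeated hne (hij ▸ h.adj i) (hij ▸ h.adj j)
  have : NeZero (2 * n) := ⟨by omega⟩
  let d : ZMod (2 * n) → V := fun z => interleave a b z.val
  have hd (k : ℕ) : d k = interleave a b k := by
    simp only [d, ZMod.val_natCast, h.interleave_periodic.map_mod_nat]
  have hd_inj : Function.Injective d := by
    intro y z hyz
    rw [← ZMod.natCast_zmod_val y, ← ZMod.natCast_zmod_val z] at hyz ⊢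
    rw [hd, hd] at hyz
    rw [ZMod.natCast_eq_natCast_iff]
    obtain ⟨k, hk | hk⟩ := Nat.even_or_odd' y.val <;>
    obtain ⟨l, hl | hl⟩ := Nat.even_or_odd' z.val <;>
    simp only [hk, hl, interleave_two_mul, interleave_two_mul_add_one] at hyz ⊢
    · exact ((ZMod.natCast_eq_natCast_iff _ _ _).1 (hai _ _ hyz)).mul_left' 2
    · exact absurd hyz (hab _ _)
    · exact absurd hyz.symm (hab _ _)
    · exact (((ZMod.natCast_eq_natCast_iff _ _ _).1 (hbi _ _ hyz)).mul_left' 2).add_right 1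
  have hd_adj (z : ZMod (2 * n)) : G.Adj (d z) (d (z + 1)) := by
    have := h.interleave_adj z.val
    rwa [← hd, ← hd, Nat.cast_add, ZMod.natCast_zmod_val, Nat.cast_one] at this
  obtain ⟨e, he, hne, y, z, rfl⟩ := hG (2 * n) d ⟨by omega, hd_inj, hd_adj⟩ (by omega)
  have cycle_edge (k : ℕ) : s(interleave a b k, interleave a b (k + 1)) ∈ cycEdges (2 * n) d :=
    ⟨k, by rw [← hd, ← hd, Nat.cast_succ]⟩
  have final {p r : ℕ} (hadj : G.Adj (a p) (b r)) (hne : s(a p, b r) ∉ cycEdges (2 * n) d) :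
      ∃ p r : ℕ, G.Adj (a p) (b r) ∧ (r : ZMod n) ≠ p ∧ ((r + 1 : ℕ) : ZMod n) ≠ p := by
    refine ⟨p, r, hadj, fun h1 => hne ?_, fun h1 => hne ?_⟩
    · have := cycle_edge (2 * p)
      rwa [interleave_two_mul, interleave_two_mul_add_one, ← eq_of_cast h.right h1] at this
    · have := cycle_edge (2 * r + 1)
      rwa [interleave_two_mul_add_one, show 2 * r + 1 + 1 = 2 * (r + 1) by ring,
        interleave_two_mul, eq_of_cast h.left h1, Sym2.eq_swap] at this
  rw [SimpleGraph.mem_edgeSet] at he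
  have hval := c.valid he
  simp only [d] at he hne hval
  obtain ⟨k, hk | hk⟩ := Nat.even_or_odd' y.val <;>
  obtain ⟨l, hl | hl⟩ := Nat.even_or_odd' z.val <;>
  simp only [hk, hl, interleave_two_mul, interleave_two_mul_add_one] at he hne hval
  · exact absurd ((ha k).trans (ha l).symm) hval
  · exact final he hne
  · exact final he.symm (Sym2.eq_swap ▸ hne)
  · have := hb k
    have := hb l
    omega

lemma walkBinomial_mem_quadIdeal (hG : LongCyclesHaveChords G) (c : G.Coloring (Fin 2)) {n : ℕ}
    (hn : 0 < n) {a b : ℕ → V} (h : IsPeriodicWalk G n a b) :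
    walkBinomial K G n a b ∈ quadIdeal K G := by
  induction n using Nat.strong_induction_on generalizing a b with
  | _ n ih =>
  obtain rfl | rfl | hn3 : n = 1 ∨ n = 2 ∨ 3 ≤ n := by omega
  · have h1 : a 1 = a 0 := h.left 0
    simp [walkBinomial, h1, edgeVar_comm (b 0) (a 0)]
  · exact walkBinomial_two_mem h
  obtain ⟨p, r, hadj, h1, h2⟩ := h.exists_chord hG c hn3
  have : NeZero n := ⟨by omega⟩
  obtain ⟨j, hjn, hj⟩ : ∃ j < n, (j : ZMod n) = r - p :=
    ⟨((r - p : ZMod n)).val, ZMod.val_lt _, ZMod.natCast_zmod_val _⟩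
  have hbj : b (p + j) = b r := by
    rw [← h.right.map_mod_nat (p + j), ← h.right.map_mod_nat r]
    congr 1
    refine (ZMod.natCast_eq_natCast_iff' _ _ _).1 ?_
    push_cast
    rw [hj]
    ring
  rw [← h.walkBinomial_shift p]
  refine walkBinomial_mem_of_chord (fun m hm hmn a b hab => ih m hmn hm hab) (h.shift p)
    (j := j) (Nat.pos_of_ne_zero ?_) (lt_of_le_of_ne hjn ?_) (by simpa [hbj] using hadj)
  · rintro rfl
    exact h1 (by linear_combination -hj)
  · intro hjn'
    have h0 : ((j + 1 : ℕ) : ZMod n) = 0 := by rw [hjn', ZMod.natCast_self]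
    refine h2 ?_
    push_cast at h0 ⊢
    linear_combination h0 - hj

lemma sum_single_le {ι σ : Type*} {s : Finset ι} {f : ι → σ} (hf : Set.InjOn f s) {u : σ →₀ ℕ}
    (hu : ∀ i ∈ s, u (f i) ≠ 0) : ∑ i ∈ s, Finsupp.single (f i) 1 ≤ u := by
  classical
  intro e
  rw [Finsupp.finsetSum_apply]
  simp only [Finsupp.single_apply]
  rw [Finset.sum_boole, Nat.cast_id]
  by_cases he : u e = 0
  · rw [he, Nat.le_zero, Finset.card_eq_zero, Finset.filter_eq_empty_iff]
    rintro i hi rfl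
    exact hu i hi he
  · refine le_trans (Finset.card_le_one.2 fun i hi j hj => ?_) (Nat.pos_of_ne_zero he)
    rw [Finset.mem_filter] at hi hj
    exact hf hi.1 hj.1 (hi.2.trans hj.2.symm)

/-- Two multisets of edges with the same degrees contain the alternate edges of a common
periodic walk. -/
lemma exists_walk [Finite V] (c : G.Coloring (Fin 2)) {u v : G.edgeSet →₀ ℕ}
    (huv : vertexDeg G u = vertexDeg G v) (hu : u ≠ 0) :
    ∃ (n : ℕ) (a b : ℕ → V), 0 < n ∧ ∃ h : IsPeriodicWalk G n a b,
      ∑ k ∈ Finset.range n, Finsupp.single (⟨s(a k, b k), h.adj k⟩ : G.edgeSet) 1 ≤ u ∧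
      ∑ k ∈ Finset.range n,
        Finsupp.single (⟨s(b k, a (k + 1)), h.adj_succ k⟩ : G.edgeSet) 1 ≤ v := by
  let S := {w : V // c w = 0 ∧ 0 < vertexDeg G u w}
  have other_end {x : G.edgeSet →₀ ℕ} {w : V} (hw : 0 < vertexDeg G x w) :
      ∃ (w' : V) (hadj : G.Adj w w'), x ⟨s(w, w'), hadj⟩ ≠ 0 ∧ 0 < vertexDeg G x w' := by
    obtain ⟨⟨e, he⟩, hxe, hwe⟩ := vertexDeg_apply_pos_iff.1 hw
    obtain ⟨w', rfl⟩ := Sym2.mem_iff_exists.1 hwe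
    exact ⟨w', he, hxe, vertexDeg_apply_pos_iff.2 ⟨_, hxe, Sym2.mem_mk_right _ _⟩⟩
  have step (w : S) : ∃ (b : V) (w' : S) (h1 : G.Adj w.1 b) (h2 : G.Adj b w'.1),
      u ⟨s(w.1, b), h1⟩ ≠ 0 ∧ v ⟨s(b, w'.1), h2⟩ ≠ 0 := by
    obtain ⟨b, h1, hub, hb⟩ := other_end w.2.2
    obtain ⟨w', h2, hvw, hw'⟩ := other_end (huv ▸ hb)
    refine ⟨b, ⟨w', ?_, huv ▸ hw'⟩, h1, h2, hub, hvw⟩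
    have := c.valid h1
    have := c.valid h2
    have := w.2.1
    omega
  choose β φ h1 h2 hu' hv' using step
  have nonempty : Nonempty S := by
    obtain ⟨⟨e, he⟩, hue⟩ := Finsupp.ne_iff.1 hu
    induction e with
    | h x y =>
      have hxy : c x ≠ c y := c.valid he
      have hx : 0 < vertexDeg G u x := vertexDeg_apply_pos_iff.2 ⟨_, hue, Sym2.mem_mk_left _ _⟩
      have hy : 0 < vertexDeg G u y := vertexDeg_apply_pos_iff.2 ⟨_, hue, Sym2.mem_mk_right _ _⟩
      by_cases hx0 : c x = 0
      · exact ⟨x, hx0, hx⟩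
      · exact ⟨y, by omega, hy⟩
  obtain ⟨s₀⟩ := nonempty
  obtain ⟨w, hw⟩ : ∃ w, w ∈ Function.periodicPts φ := by
    obtain ⟨i, j, hne, hij⟩ := Finite.exists_ne_map_eq_of_infinite fun k => φ^[k] s₀
    wlog hlt : i < j generalizing i j
    · exact this j i hne.symm hij.symm (by omega)
    refine ⟨φ^[i] s₀, Function.mk_mem_periodicPts (Nat.sub_pos_of_lt hlt) ?_⟩
    rw [Function.IsPeriodicPt, Function.IsFixedPt, ← Function.iterate_add_apply,
      Nat.sub_add_cancel hlt.le]
    exact hij.symm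
  have hper : Function.Periodic (fun k => φ^[k] w) (Function.minimalPeriod φ w) := fun _ =>
    Function.iterate_add_minimalPeriod_eq
  have hinj : Set.InjOn (fun k => φ^[k] w) (Set.Iio (Function.minimalPeriod φ w)) :=
    Function.iterate_injOn_Iio_minimalPeriod
  have hsucc (k : ℕ) : φ^[k + 1] w = φ (φ^[k] w) := Function.iterate_succ_apply' _ _ _
  have hβ (s : S) : c (β s) ≠ 0 := fun h => c.valid (h1 s) (s.2.1.trans h.symm)
  have cancel {x y : S} {x' y' : V} (hx : c x' ≠ 0) (hy : c y' ≠ 0)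
      (h : s(x.1, x') = s(y.1, y')) : x = y := by
    obtain ⟨h, -⟩ | ⟨h, -⟩ := Sym2.eq_iff.1 h
    · exact Subtype.ext h
    · exact absurd (h ▸ x.2.1) hy
  refine ⟨Function.minimalPeriod φ w, fun k => (φ^[k] w).1, fun k => β (φ^[k] w),
    Function.minimalPeriod_pos_of_mem_periodicPts hw,
    { left := hper.comp Subtype.val
      right := hper.comp β
      adj := fun k => h1 _
      adj_succ := fun k => hsucc k ▸ h2 _ },
    sum_single_le ?_ fun k _ => hu' _, sum_single_le ?_ fun k _ => ?_⟩
  · intro k hk l hl hkl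
    rw [Finset.coe_range] at hk hl
    exact hinj hk hl (cancel (hβ _) (hβ _) (Subtype.mk.inj hkl))
  · intro k hk l hl hkl
    rw [Finset.coe_range] at hk hl
    have hkl' : φ^[k + 1] w = φ^[l + 1] w :=
      cancel (hβ _) (hβ _) (Sym2.eq_swap.trans ((Subtype.mk.inj hkl).trans Sym2.eq_swap))
    have back (m : ℕ) : φ^[Function.minimalPeriod φ w - 1] (φ^[m + 1] w) = φ^[m] w := by
      have := Function.minimalPeriod_pos_of_mem_periodicPts hw
      rw [← Function.iterate_add_apply,
        show Function.minimalPeriod φ w - 1 + (m + 1) = m + Function.minimalPeriod φ w by omega,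
        Function.iterate_add_minimalPeriod_eq]
    refine hinj hk hl ?_
    change φ^[k] w = φ^[l] w
    rw [← back k, ← back l, hkl']
  · simp only [hsucc]
    exact hv' _

lemma IsPeriodicWalk.walkBinomial_eq {n : ℕ} {a b : ℕ → V} (h : IsPeriodicWalk G n a b) :
    walkBinomial K G n a b =
      monomial (∑ k ∈ Finset.range n,
        Finsupp.single (⟨s(a k, b k), h.adj k⟩ : G.edgeSet) 1) 1 -
      monomial (∑ k ∈ Finset.range n,
        Finsupp.single (⟨s(b k, a (k + 1)), h.adj_succ k⟩ : G.edgeSet) 1) 1 := by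
  simp only [walkBinomial, monomial_sum_one, edgeVar_of_adj (h.adj _),
    edgeVar_of_adj (h.adj_succ _)]
  rfl

lemma monomial_sub_mem_quadIdeal [Finite V] (hG : LongCyclesHaveChords G)
    (c : G.Coloring (Fin 2)) {u v : G.edgeSet →₀ ℕ} (huv : vertexDeg G u = vertexDeg G v) :
    (monomial u 1 - monomial v 1 : MvPolynomial G.edgeSet K) ∈ quadIdeal K G := by
  induction hN : u.degree using Nat.strong_induction_on generalizing u v with
  | _ N ih =>
  subst hN
  by_cases hu : u = 0
  · have hv : v.degree = 0 := by
      have := degree_vertexDeg v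
      rw [← huv, hu] at this
      simpa using this
    rw [hu, (Finsupp.degree_eq_zero_iff v).1 hv, sub_self]
    exact zero_mem _
  obtain ⟨n, a, b, hn, h, hUu, hVv⟩ := exists_walk c huv hu
  have hmem := walkBinomial_mem_quadIdeal (K := K) hG c hn h
  rw [h.walkBinomial_eq] at hmem
  have hdeg : 0 < (∑ k ∈ Finset.range n,
      Finsupp.single (⟨s(a k, b k), h.adj k⟩ : G.edgeSet) 1).degree := by
    simpa using hn
  set U := ∑ k ∈ Finset.range n, Finsupp.single (⟨s(a k, b k), h.adj k⟩ : G.edgeSet) 1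
  set W := ∑ k ∈ Finset.range n,
    Finsupp.single (⟨s(b k, a (k + 1)), h.adj_succ k⟩ : G.edgeSet) 1
  have hUW := monomial_sub_mem_toricIdeal_iff.1 (quadIdeal_le_toricIdeal hmem)
  obtain ⟨u, rfl⟩ := exists_add_of_le hUu
  obtain ⟨v, rfl⟩ := exists_add_of_le hVv
  rw [map_add, map_add, hUW, add_left_cancel_iff] at huv
  have hrec := ih u.degree (by rw [map_add]; omega) huv rfl
  have key : (monomial (U + u) 1 - monomial (W + v) 1 : MvPolynomial G.edgeSet K) =
      monomial u 1 * (monomial U 1 - monomial W 1) +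
        monomial W 1 * (monomial u 1 - monomial v 1) := by
    rw [← one_mul (1 : K), ← monomial_mul, ← monomial_mul, one_mul]
    ring
  rw [key]
  exact add_mem (Ideal.mul_mem_left _ _ hmem) (Ideal.mul_mem_left _ _ hrec)

lemma isQuadBinomialGen_toricIdeal [Finite V] (hG : LongCyclesHaveChords G)
    (c : G.Coloring (Fin 2)) : IsQuadBinomialGen (toricIdeal K G) :=
  ⟨_, le_antisymm (toricIdeal_le_of_binomial_mem fun _ _ => monomial_sub_mem_quadIdeal hG c)
    quadIdeal_le_toricIdeal, fun _ hf => hf.2⟩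

/-- If `u` only admits itself among the multisets of edges with the same degrees sharing an edge
with it, then no quadratic move applies to `u`. -/
lemma coeff_eq_zero_of_isQuadBinomialGen (hI : IsQuadBinomialGen (toricIdeal K G))
    {u : G.edgeSet →₀ ℕ} (hu : 3 ≤ u.degree)
    (huniq : ∀ w e, vertexDeg G w = vertexDeg G u → u e ≠ 0 → w e ≠ 0 → w = u)
    {f : MvPolynomial G.edgeSet K} (hf : f ∈ toricIdeal K G) : coeff u f = 0 := by
  classical
  obtain ⟨S, hS, hquad⟩ := hI
  have move {m p p' : G.edgeSet →₀ ℕ} (hp : p.degree = 2) (hpp : vertexDeg G p = vertexDeg G p')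
      (hmp : m + p = u) : m + p' = u := by
    have hm : m ≠ 0 := by
      rintro rfl
      rw [zero_add] at hmp
      rw [← hmp, hp] at hu
      omega
    obtain ⟨e, he⟩ := Finsupp.ne_iff.1 hm
    rw [Finsupp.zero_apply] at he
    refine huniq _ e ?_ ?_ ?_
    · rw [← hmp, map_add, map_add, hpp]
    · rw [← hmp, Finsupp.add_apply]
      omega
    · rw [Finsupp.add_apply]
      omega
  have key : ∀ f ∈ Ideal.span S, ∀ r, coeff u (r * f) = 0 := by
    intro f hf
    induction hf using Submodule.span_induction with
    | zero => simp
    | add x y _ _ hx hy => intro r; rw [mul_add, coeff_add, hx, hy, add_zero]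
    | smul s x _ hx => intro r; rw [smul_eq_mul, ← mul_assoc, hx]
    | mem x hxS =>
      have hxI : x ∈ toricIdeal K G := hS ▸ Ideal.subset_span hxS
      obtain ⟨i, j, k, l, rfl⟩ := hquad x hxS
      have hX (i j : G.edgeSet) : (X i * X j : MvPolynomial G.edgeSet K) =
          monomial (Finsupp.single i 1 + Finsupp.single j 1) 1 := by
        simp [X, monomial_mul]
      rw [hX, hX] at hxI ⊢
      have hdeg := monomial_sub_mem_toricIdeal_iff.1 hxI
      have hiff (m : G.edgeSet →₀ ℕ) :
          m + (Finsupp.single i 1 + Finsupp.single j 1) = u ↔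
            m + (Finsupp.single k 1 + Finsupp.single l 1) = u :=
        ⟨move (by simp) hdeg, move (by simp) hdeg.symm⟩
      intro r
      induction r using MvPolynomial.induction_on' with
      | monomial m a =>
        rw [mul_sub, monomial_mul, monomial_mul, coeff_sub, coeff_monomial, coeff_monomial]
        simp only [hiff, sub_self]
      | add p q hp hq => rw [add_mul, coeff_add, hp, hq, add_zero]
  simpa using key f (hS ▸ hf) 1

section Cycle

variable {q : ℕ} {c : ZMod q → V}

/-- The `i`-th edge of a cycle. -/
def cycleEdge (hc : IsCycleOn' G q c) (i : ZMod q) : G.edgeSet := ⟨s(c i, c (i + 1)), hc.2.2 i⟩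

lemma cycleEdge_injective (hc : IsCycleOn' G q c) : Function.Injective (cycleEdge hc) := by
  intro i j hij
  obtain ⟨h, -⟩ | ⟨h1, h2⟩ := Sym2.eq_iff.1 (Subtype.mk.inj hij)
  · exact hc.2.1 h
  · have h1 := hc.2.1 h1
    have h2 := hc.2.1 h2
    have h3 : ((2 : ℕ) : ZMod q) = 0 := by
      push_cast
      linear_combination h2 - h1
    rw [ZMod.natCast_eq_zero_iff] at h3
    have := hc.1
    exact absurd (Nat.le_of_dvd two_pos h3) (by omega)

lemma vertexDeg_apply_of_support_subset_cycle [NeZero q] (hc : IsCycleOn' G q c)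
    {w : G.edgeSet →₀ ℕ} (hw : ∀ e, w e ≠ 0 → e ∈ Set.range (cycleEdge hc)) (j : ZMod q) :
    vertexDeg G w (c (j + 1)) = w (cycleEdge hc (j + 1)) + w (cycleEdge hc j) := by
  classical
  have hsum : w = ∑ i, Finsupp.single (cycleEdge hc i) (w (cycleEdge hc i)) := by
    ext e
    rw [Finsupp.finsetSum_apply]
    by_cases he : w e = 0
    · refine he.trans (Finset.sum_eq_zero fun i _ => ?_).symm
      rw [Finsupp.single_apply]
      split_ifs with h
      · rw [h, he]
      · rfl
    · obtain ⟨i, rfl⟩ := hw e he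
      rw [Finset.sum_eq_single i] <;>
        simp +contextual [(cycleEdge_injective hc).eq_iff]
  conv_lhs => rw [hsum]
  simp only [map_sum, vertexDeg_single, Finsupp.finsetSum_apply, cycleEdge, edgeExp_mk,
    Finsupp.smul_apply, Finsupp.add_apply, Finsupp.single_apply, hc.2.1.eq_iff, add_left_inj,
    smul_eq_mul, mul_add, Finset.sum_add_distrib, mul_ite, mul_one, mul_zero]
  simp

/-- The sum of the edges of the cycle which start in a vertex of colour `x`. -/
noncomputable def alternateEdges [NeZero q] (hc : IsCycleOn' G q c) (col : G.Coloring (Fin 2))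
    (x : Fin 2) : G.edgeSet →₀ ℕ :=
  ∑ i with col (c i) = x, Finsupp.single (cycleEdge hc i) 1

lemma vertexDeg_alternateEdges [NeZero q] (hc : IsCycleOn' G q c) (col : G.Coloring (Fin 2))
    (x : Fin 2) :
    vertexDeg G (alternateEdges hc col x) = ∑ i, Finsupp.single (c i) 1 := by
  simp only [alternateEdges, map_sum, vertexDeg_single, cycleEdge, edgeExp_mk, one_smul,
    Finset.sum_add_distrib]
  rw [← Finset.sum_filter_add_sum_filter_not Finset.univ (fun i => col (c i) = x)]
  congr 1
  refine Finset.sum_equiv (Equiv.addRight 1) (fun i => ?_) fun i _ => rfl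
  have := col.valid (hc.2.2 i)
  simp only [Finset.mem_filter_univ, Equiv.coe_addRight]
  omega

lemma alternateEdges_apply [NeZero q] (hc : IsCycleOn' G q c) (col : G.Coloring (Fin 2))
    (x : Fin 2) (i : ZMod q) :
    alternateEdges hc col x (cycleEdge hc i) = if col (c i) = x then 1 else 0 := by
  classical
  simp [alternateEdges, Finsupp.finsetSum_apply, Finsupp.single_apply,
    (cycleEdge_injective hc).eq_iff]

/-- In a chordless cycle, a multiset of edges covering each vertex of the cycle once is
determined by any edge in it. -/
lemma eq_alternateEdges_of_no_chord [NeZero q] (hc : IsCycleOn' G q c)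
    (hno : ∀ e, ¬ IsChord G q c e) (col : G.Coloring (Fin 2)) (x : Fin 2)
    {w : G.edgeSet →₀ ℕ} (hw : vertexDeg G w = vertexDeg G (alternateEdges hc col x))
    {e : G.edgeSet} (he : alternateEdges hc col x e ≠ 0) (hwe : w e ≠ 0) :
    w = alternateEdges hc col x := by
  classical
  have support {y : G.edgeSet →₀ ℕ} (hy : vertexDeg G y = vertexDeg G (alternateEdges hc col x))
      (e : G.edgeSet) (hye : y e ≠ 0) : e ∈ Set.range (cycleEdge hc) := by
    have vertex {z : V} (hz : z ∈ e.1) : ∃ i, c i = z := by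
      have := vertexDeg_apply_pos_iff.2 ⟨e, hye, hz⟩
      rw [hy, vertexDeg_alternateEdges, Finsupp.finsetSum_apply, Finset.sum_pos_iff] at this
      obtain ⟨i, -, hi⟩ := this
      rw [Finsupp.single_apply] at hi
      exact ⟨i, by grind⟩
    obtain ⟨e, heG⟩ := e
    induction e with
    | h a b =>
      obtain ⟨i, rfl⟩ := vertex (Sym2.mem_mk_left a b)
      obtain ⟨j, rfl⟩ := vertex (Sym2.mem_mk_right _ b)
      by_contra hne
      exact hno _ ⟨heG, fun ⟨k, hk⟩ => hne ⟨k, Subtype.ext hk.symm⟩, i, j, rfl⟩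
  have hdeg {y : G.edgeSet →₀ ℕ} (hy : vertexDeg G y = vertexDeg G (alternateEdges hc col x))
      (j : ZMod q) : y (cycleEdge hc (j + 1)) + y (cycleEdge hc j) = 1 := by
    rw [← vertexDeg_apply_of_support_subset_cycle hc (support hy), hy, vertexDeg_alternateEdges]
    simp [Finsupp.finsetSum_apply, Finsupp.single_apply, hc.2.1.eq_iff]
  obtain ⟨i, rfl⟩ := support rfl e he
  have agree (k : ℕ) :
      w (cycleEdge hc (i + k)) = alternateEdges hc col x (cycleEdge hc (i + k)) := by
    induction k with
    | zero =>
      have h1 := hdeg hw i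
      have h2 := hdeg rfl i
      rw [Nat.cast_zero, add_zero]
      omega
    | succ k ih =>
      have h1 := hdeg hw (i + k)
      have h2 := hdeg rfl (i + k)
      rw [Nat.cast_succ, ← add_assoc]
      omega
  ext e
  by_cases hmem : e ∈ Set.range (cycleEdge hc)
  · obtain ⟨j, rfl⟩ := hmem
    simpa using agree (j - i).val
  · rw [not_not.1 fun h => hmem (support hw e h), not_not.1 fun h => hmem (support rfl e h)]

end Cycle

lemma longCyclesHaveChords_of_isQuadBinomialGen (col : G.Coloring (Fin 2))
    (hI : IsQuadBinomialGen (toricIdeal K G)) : LongCyclesHaveChords G := by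
  intro q c hc hq
  by_contra! hno
  have : NeZero q := ⟨by omega⟩
  have hdeg : 3 ≤ (alternateEdges hc col 0).degree := by
    have := degree_vertexDeg (alternateEdges hc col 0)
    rw [vertexDeg_alternateEdges] at this
    simp only [map_sum, Finsupp.degree_single, Finset.sum_const, Finset.card_univ, ZMod.card,
      smul_eq_mul, mul_one] at this
    omega
  have h := coeff_eq_zero_of_isQuadBinomialGen hI hdeg
    (fun w e hw => eq_alternateEdges_of_no_chord hc hno col 0 hw)
    (monomial_sub_mem_toricIdeal_iff.2 ((vertexDeg_alternateEdges hc col 0).trans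
      (vertexDeg_alternateEdges hc col 1).symm))
  classical
  rw [coeff_sub, coeff_monomial, coeff_monomial, if_pos rfl, if_neg, sub_zero] at h
  · exact one_ne_zero h
  · intro heq
    have := DFunLike.congr_fun heq (cycleEdge hc 0)
    rw [alternateEdges_apply, alternateEdges_apply] at this
    split_ifs at this <;> omega

end ToricGraph

/-- For a finite connected bipartite graph, every cycle of length `≥ 6` has a chord if
and only if `I_G` is generated by quadratic binomials. -/
theorem bipartite_chord_iff_quadGen {V : Type*} [Fintype V] (K : Type*) [Field K]
    (G : SimpleGraph V) (hG : G.Connected) (hbip : G.Colorable 2) :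
    (∀ (q : ℕ) (c : ZMod q → V), IsCycleOn' G q c → 6 ≤ q → ∃ e, IsChord G q c e) ↔
      IsQuadBinomialGen (toricIdeal K G) := by
  obtain ⟨c⟩ := hbip
  exact ⟨fun h => ToricGraph.isQuadBinomialGen_toricIdeal h c,
    ToricGraph.longCyclesHaveChords_of_isQuadBinomialGen c⟩
end

section
/- Let G be a finite connected simple bipartite graph. Then every cycle of G of length ≥ 6 has a chord if and only if I_G possesses a quadratic Gröbner basis. -/
set_option linter.unusedVariables false

open MvPolynomial

universe uv

/-- The initial ideal of `I` with respect to a monomial order: the ideal generated by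
the leading monomials of the nonzero elements of `I`. -/
noncomputable def initialIdeal {σ : Type uv} {K : Type*} [Field K] (m : MonomialOrder.{uv, uv} σ)
    (I : Ideal (MvPolynomial σ K)) : Ideal (MvPolynomial σ K) :=
  Ideal.span { g | ∃ f ∈ I, f ≠ 0 ∧ ∃ d ∈ f.support,
    (∀ d' ∈ f.support, m.toSyn d' ≤ m.toSyn d) ∧ g = monomial d (1 : K) }

/-- `I` possesses a quadratic Gröbner basis: for some monomial order, the initial
ideal of `I` is generated by monomials of degree `2`. -/
def HasQuadraticGB {σ : Type uv} {K : Type*} [Field K] (I : Ideal (MvPolynomial σ K)) : Prop :=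
  ∃ m : MonomialOrder.{uv, uv} σ, ∃ S : Set (MvPolynomial σ K),
    initialIdeal m I = Ideal.span S ∧ ∀ f ∈ S, ∃ i j : σ, f = X i * X j

/-! ### Toric ideals of graphs and vertex degrees -/

section Toric

variable {V : Type*} (K : Type*) [Field K] (G : SimpleGraph V)

/-- The exponent vector of the monomial `t_a t_b` associated to an edge. -/
noncomputable def edgeVec (e : Sym2 V) : V →₀ ℕ :=
  Sym2.lift ⟨fun a b => Finsupp.single a 1 + Finsupp.single b 1, fun _ _ => add_comm _ _⟩ e

@[simp]
lemma edgeVec_mk (a b : V) : edgeVec s(a, b) = Finsupp.single a 1 + Finsupp.single b 1 := rfl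

lemma edgeMon_eq_monomial (e : Sym2 V) : edgeMon K e = monomial (edgeVec e) 1 := by
  induction e with
  | _ a b => simp [edgeMon, edgeVec, X, monomial_mul]

lemma one_le_edgeVec_apply {e : Sym2 V} {v : V} (h : v ∈ e) : 1 ≤ edgeVec e v := by
  induction e with
  | _ a b =>
    rcases Sym2.mem_iff.1 h with rfl | rfl <;> simp

lemma mem_of_edgeVec_apply_ne_zero {e : Sym2 V} {v : V} (h : edgeVec e v ≠ 0) : v ∈ e := by
  classical
  induction e with
  | _ a b =>
    rw [Sym2.mem_iff]
    by_contra! hv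
    simp [hv.1.symm, hv.2.symm] at h

/-- The exponent vector of the image of a monomial under the toric map. -/
noncomputable def degVec : (G.edgeSet →₀ ℕ) →ₗ[ℕ] (V →₀ ℕ) :=
  Finsupp.linearCombination ℕ fun e : G.edgeSet => edgeVec e.1

@[simp]
lemma degVec_single (e : G.edgeSet) : degVec G (Finsupp.single e 1) = edgeVec e.1 := by
  simp [degVec]

lemma degVec_apply (d : G.edgeSet →₀ ℕ) (v : V) :
    degVec G d v = d.sum fun e n => n * edgeVec e.1 v := by
  simp [degVec, Finsupp.linearCombination_apply, Finsupp.sum]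

lemma aeval_edgeMon_monomial (d : G.edgeSet →₀ ℕ) (k : K) :
    aeval (R := K) (fun e : G.edgeSet => edgeMon K e.1) (monomial d k)
      = monomial (degVec G d) k := by
  simp only [aeval_monomial, edgeMon_eq_monomial, monomial_pow, one_pow, Finsupp.prod,
    degVec, Finsupp.linearCombination_apply, Finsupp.sum]
  rw [← monomial_sum_one, algebraMap_eq, C_mul_monomial, mul_one]

lemma monomial_sub_monomial_mem_toricIdeal {d d' : G.edgeSet →₀ ℕ}
    (h : degVec G d = degVec G d') :
    monomial d (1 : K) - monomial d' 1 ∈ toricIdeal K G := by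
  rw [toricIdeal, RingHom.mem_ker, map_sub]
  simp only [aeval_edgeMon_monomial, h, sub_self]

lemma exists_ne_of_mem_toricIdeal {f : MvPolynomial G.edgeSet K} (hf : f ∈ toricIdeal K G)
    {d : G.edgeSet →₀ ℕ} (hd : d ∈ f.support) :
    ∃ d' ∈ f.support, d' ≠ d ∧ degVec G d' = degVec G d := by
  classical
  by_contra! h
  rw [toricIdeal, RingHom.mem_ker] at hf
  have h0 := congrArg (coeff (degVec G d)) hf
  rw [f.as_sum, map_sum] at h0
  simp only [aeval_edgeMon_monomial, coeff_sum, coeff_monomial, coeff_zero] at h0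
  rw [Finset.sum_eq_single_of_mem d hd fun b hb hbd => if_neg (h b hb hbd), if_pos rfl] at h0
  exact (mem_support_iff.1 hd) h0

lemma degVec_apply_mono {d d' : G.edgeSet →₀ ℕ} (h : d ≤ d') (v : V) :
    degVec G d v ≤ degVec G d' v := by
  obtain ⟨u, rfl⟩ := exists_add_of_le h
  simp

variable {G}

lemma degVec_apply_ne_zero {d : G.edgeSet →₀ ℕ} {e : G.edgeSet} (he : d e ≠ 0) {v : V}
    (hv : v ∈ e.1) : degVec G d v ≠ 0 := by
  have h := degVec_apply_mono G (Finsupp.single_le_iff.2 (Nat.one_le_iff_ne_zero.2 he)) v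
  rw [degVec_single] at h
  have := one_le_edgeVec_apply hv
  omega

lemma exists_mem_of_degVec_apply_ne_zero {d : G.edgeSet →₀ ℕ} {v : V} (h : degVec G d v ≠ 0) :
    ∃ e : G.edgeSet, d e ≠ 0 ∧ v ∈ e.1 := by
  rw [degVec_apply] at h
  obtain ⟨e, he, hne⟩ := Finset.exists_ne_zero_of_sum_ne_zero h
  exact ⟨e, Finsupp.mem_support_iff.1 he,
    mem_of_edgeVec_apply_ne_zero (right_ne_zero_of_mul hne)⟩

lemma eq_zero_of_degVec_eq_zero {d : G.edgeSet →₀ ℕ} (h : degVec G d = 0) : d = 0 := by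
  ext e
  by_contra he
  obtain ⟨v, hv⟩ : ∃ v, v ∈ e.1 := ⟨_, Sym2.out_fst_mem e.1⟩
  exact degVec_apply_ne_zero he hv (by rw [h]; rfl)

lemma single_add_single_le {σ : Type*} {d : σ →₀ ℕ} {i j : σ} (hij : i ≠ j) (hi : d i ≠ 0)
    (hj : d j ≠ 0) : Finsupp.single i 1 + Finsupp.single j 1 ≤ d := by
  classical
  intro x
  simp only [Finsupp.add_apply, Finsupp.single_apply]
  split_ifs with h h' h'
  · exact absurd (h.trans h'.symm) hij
  · subst h; omega
  · subst h'; omega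
  · omega

end Toric

/-! ### Monomial ideals generated by quadrics -/

section Quadratic

variable {σ : Type uv} {K : Type*} [Field K]

lemma X_mul_X_eq_monomial (i j : σ) :
    (X i * X j : MvPolynomial σ K) = monomial (Finsupp.single i 1 + Finsupp.single j 1) 1 := by
  simp [X, monomial_mul]

/-- The exponents of the leading monomials of the nonzero elements of an ideal. -/
def leadingExponents (m : MonomialOrder.{uv, uv} σ) (I : Ideal (MvPolynomial σ K)) :
    Set (σ →₀ ℕ) :=
  {d | ∃ f ∈ I, d ∈ f.support ∧ ∀ d' ∈ f.support, m.toSyn d' ≤ m.toSyn d}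

lemma initialIdeal_eq_span_image (m : MonomialOrder.{uv, uv} σ) (I : Ideal (MvPolynomial σ K)) :
    initialIdeal m I
      = Ideal.span ((fun d => monomial d (1 : K)) '' leadingExponents m I) := by
  unfold initialIdeal leadingExponents
  congr 1
  ext g
  constructor
  · rintro ⟨f, hf, -, d, hd, hmax, rfl⟩
    exact ⟨d, ⟨f, hf, hd, hmax⟩, rfl⟩
  · rintro ⟨d, ⟨f, hf, hd, hmax⟩, rfl⟩
    refine ⟨f, hf, ?_, d, hd, hmax, rfl⟩
    rintro rfl
    simp at hd

lemma mem_leadingExponents_of_degVec_eq {V : Type uv} {G : SimpleGraph V}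
    {m : MonomialOrder.{uv, uv} G.edgeSet} {d d' : G.edgeSet →₀ ℕ}
    (h : degVec G d = degVec G d') (hne : d ≠ d') (hle : m.toSyn d' ≤ m.toSyn d) :
    d ∈ leadingExponents m (toricIdeal K G) := by
  classical
  refine ⟨_, monomial_sub_monomial_mem_toricIdeal K G h, ?_, fun u hu => ?_⟩
  · simp [coeff_monomial, hne.symm]
  · rcases Finset.mem_union.1 (support_sub _ _ _ hu) with hu | hu <;>
      rw [Finset.mem_singleton.1 (support_monomial_subset hu)]
    exact hle

lemma monomial_mem_span_image_iff (d : σ →₀ ℕ) (s : Set (σ →₀ ℕ)) :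
    monomial d (1 : K) ∈ Ideal.span ((fun d => monomial d (1 : K)) '' s) ↔ ∃ t ∈ s, t ≤ d := by
  classical
  rw [mem_ideal_span_monomial_image]
  simp [support_monomial]

/-- A leading exponent of an ideal with a quadratic initial ideal dominates the exponent of a
product of two variables, which in turn dominates a leading exponent. -/
lemma exists_quadratic_le_of_mem_leadingExponents {m : MonomialOrder.{uv, uv} σ}
    {I : Ideal (MvPolynomial σ K)} {S : Set (MvPolynomial σ K)}
    (hS : initialIdeal m I = Ideal.span S) (hquad : ∀ f ∈ S, ∃ i j : σ, f = X i * X j)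
    {d : σ →₀ ℕ} (hd : d ∈ leadingExponents m I) :
    ∃ i j : σ, Finsupp.single i 1 + Finsupp.single j 1 ≤ d ∧
      ∃ t ∈ leadingExponents m I, t ≤ Finsupp.single i 1 + Finsupp.single j 1 := by
  set T : Set (σ →₀ ℕ) := {t | monomial t (1 : K) ∈ S}
  have hST : S = (fun t => monomial t (1 : K)) '' T := by
    ext f
    constructor
    · intro hf
      obtain ⟨i, j, rfl⟩ := hquad f hf
      rw [X_mul_X_eq_monomial] at hf ⊢
      exact ⟨_, hf, rfl⟩
    · rintro ⟨t, ht, rfl⟩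
      exact ht
  have hdS : monomial d (1 : K) ∈ Ideal.span S := by
    rw [← hS, initialIdeal_eq_span_image]
    exact Ideal.subset_span ⟨d, hd, rfl⟩
  rw [hST, monomial_mem_span_image_iff] at hdS
  obtain ⟨t, ht, htd⟩ := hdS
  obtain ⟨i, j, hij⟩ := hquad _ ht
  rw [X_mul_X_eq_monomial] at hij
  obtain rfl := monomial_left_injective one_ne_zero hij
  refine ⟨i, j, htd, ?_⟩
  rw [← monomial_mem_span_image_iff (K := K), ← initialIdeal_eq_span_image, hS]
  exact Ideal.subset_span ht

end Quadratic

/-! ### Orderings of the edges without the configuration `Γ` -/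

section GammaFree

variable {V : Type uv} {G : SimpleGraph V}

/-- An ordering `r` of the vertices of a graph with a 2-colouring `C` is `Γ`-free if the ordered
bipartite adjacency matrix has no submatrix `(1 1; 1 0)`. -/
def IsGammaFree (G : SimpleGraph V) (C : G.Coloring (Fin 2)) (r : V → ℕ) : Prop :=
  ∀ a a' b b' : V, C a = 0 → C a' = 0 → r a < r a' → r b < r b' →
    G.Adj a b → G.Adj a b' → G.Adj a' b → G.Adj a' b'

lemma exists_endpoint_of_color (C : G.Coloring (Fin 2)) (e : G.edgeSet) :
    ∃ p : V × V, C p.1 = 0 ∧ C p.2 = 1 ∧ e.1 = s(p.1, p.2) := by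
  obtain ⟨e, he⟩ := e
  induction e with
  | _ a b =>
    have hab : C a ≠ C b := C.valid he
    have h2 : ∀ x y : Fin 2, x ≠ y → (x = 0 ∧ y = 1) ∨ (x = 1 ∧ y = 0) := by decide
    rcases h2 _ _ hab with h | h
    · exact ⟨(a, b), h.1, h.2, rfl⟩
    · exact ⟨(b, a), h.2, h.1, Sym2.eq_swap⟩

/-- The endpoint of an edge of colour `0`. -/
noncomputable def rowEnd (C : G.Coloring (Fin 2)) (e : G.edgeSet) : V :=
  (exists_endpoint_of_color C e).choose.1

/-- The endpoint of an edge of colour `1`. -/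
noncomputable def colEnd (C : G.Coloring (Fin 2)) (e : G.edgeSet) : V :=
  (exists_endpoint_of_color C e).choose.2

variable (C : G.Coloring (Fin 2))

lemma color_rowEnd (e : G.edgeSet) : C (rowEnd C e) = 0 :=
  (exists_endpoint_of_color C e).choose_spec.1

lemma color_colEnd (e : G.edgeSet) : C (colEnd C e) = 1 :=
  (exists_endpoint_of_color C e).choose_spec.2.1

lemma coe_eq_rowEnd_colEnd (e : G.edgeSet) : e.1 = s(rowEnd C e, colEnd C e) :=
  (exists_endpoint_of_color C e).choose_spec.2.2

lemma adj_rowEnd_colEnd (e : G.edgeSet) : G.Adj (rowEnd C e) (colEnd C e) := by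
  rw [← SimpleGraph.mem_edgeSet, ← coe_eq_rowEnd_colEnd C e]
  exact e.2

lemma edge_ext {e e' : G.edgeSet} (h : rowEnd C e = rowEnd C e') (h' : colEnd C e = colEnd C e') :
    e = e' := by
  apply Subtype.ext
  rw [coe_eq_rowEnd_colEnd C e, coe_eq_rowEnd_colEnd C e', h, h']

lemma exists_edge_of_adj {a b : V} (ha : C a = 0) (hab : G.Adj a b) :
    ∃ e : G.edgeSet, rowEnd C e = a ∧ colEnd C e = b := by
  refine ⟨⟨s(a, b), hab⟩, ?_⟩
  have h := coe_eq_rowEnd_colEnd C ⟨s(a, b), hab⟩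
  rw [Sym2.eq_iff] at h
  rcases h with h | h
  · exact ⟨h.1.symm, h.2.symm⟩
  · have := color_colEnd C ⟨s(a, b), hab⟩
    rw [← h.1, ha] at this
    simp at this

lemma edgeVec_edge (e : G.edgeSet) :
    edgeVec e.1 = Finsupp.single (rowEnd C e) 1 + Finsupp.single (colEnd C e) 1 := by
  rw [coe_eq_rowEnd_colEnd C e, edgeVec_mk]

lemma degVec_apply_of_color_zero [DecidableEq V] [Fintype G.edgeSet] (d : G.edgeSet →₀ ℕ) {v : V}
    (hv : C v = 0) : degVec G d v = ∑ e with rowEnd C e = v, d e := by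
  rw [degVec_apply, Finsupp.sum_fintype _ _ (by simp), Finset.sum_filter]
  refine Finset.sum_congr rfl fun e _ => ?_
  have : colEnd C e ≠ v := by
    rintro rfl
    simp [color_colEnd] at hv
  simp [edgeVec_edge C, Finsupp.single_apply, this]

lemma degVec_apply_of_color_one [DecidableEq V] [Fintype G.edgeSet] (d : G.edgeSet →₀ ℕ) {v : V}
    (hv : C v = 1) : degVec G d v = ∑ e with colEnd C e = v, d e := by
  rw [degVec_apply, Finsupp.sum_fintype _ _ (by simp), Finset.sum_filter]
  refine Finset.sum_congr rfl fun e _ => ?_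
  have : rowEnd C e ≠ v := by
    rintro rfl
    simp [color_rowEnd] at hv
  simp [edgeVec_edge C, Finsupp.single_apply, this]

/-- A pair of edges `{i, j'}, {i', j}` with `i < i'`, `j < j'` such that `{i, j}` is an edge. -/
def IsCrossing (r : V → ℕ) (e₂ e₃ : G.edgeSet) : Prop :=
  ∃ e₁ : G.edgeSet, rowEnd C e₁ = rowEnd C e₂ ∧ colEnd C e₁ = colEnd C e₃ ∧
    r (rowEnd C e₂) < r (rowEnd C e₃) ∧ r (colEnd C e₃) < r (colEnd C e₂)

lemma exists_lt_of_sum_eq {ι : Type*} {s : Finset ι} {f g : ι → ℕ}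
    (h : ∑ i ∈ s, f i = ∑ i ∈ s, g i) {i : ι} (hi : i ∈ s) (hlt : f i < g i) :
    ∃ j ∈ s, g j < f j := by
  by_contra! hle
  exact h.not_lt (Finset.sum_lt_sum hle ⟨i, hi, hlt⟩)

variable {C} {r : V → ℕ}

lemma exists_crossing_of_lt [Finite G.edgeSet] (hr : Function.Injective r)
    {d d' : G.edgeSet →₀ ℕ} (h : degVec G d = degVec G d') {e : G.edgeSet}
    (hmin : ∀ e', d e' ≠ d' e' →
      toLex (r (rowEnd C e), r (colEnd C e)) ≤ toLex (r (rowEnd C e'), r (colEnd C e')))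
    (hlt : d' e < d e) :
    ∃ e₂ e₃, IsCrossing C r e₂ e₃ ∧ Finsupp.single e₂ 1 + Finsupp.single e₃ 1 ≤ d' := by
  classical
  have := Fintype.ofFinite G.edgeSet
  have hrow := degVec_apply_of_color_zero C d (color_rowEnd C e)
  rw [h, degVec_apply_of_color_zero C d' (color_rowEnd C e)] at hrow
  obtain ⟨e₂, he₂, hlt₂⟩ := exists_lt_of_sum_eq hrow (i := e) (by simp) hlt
  have hcol := degVec_apply_of_color_one C d (color_colEnd C e)
  rw [h, degVec_apply_of_color_one C d' (color_colEnd C e)] at hcol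
  obtain ⟨e₃, he₃, hlt₃⟩ := exists_lt_of_sum_eq hcol (i := e) (by simp) hlt
  simp only [Finset.mem_filter, Finset.mem_univ, true_and] at he₂ he₃
  have h₂ := hmin e₂ hlt₂.ne
  have h₃ := hmin e₃ hlt₃.ne
  have hne₂ : e₂ ≠ e := by rintro rfl; omega
  have hne₃ : e₃ ≠ e := by rintro rfl; omega
  have hc₂ : r (colEnd C e₂) ≠ r (colEnd C e) := fun hc => hne₂ (edge_ext C he₂ (hr hc))
  have hc₃ : r (rowEnd C e₃) ≠ r (rowEnd C e) := fun hc => hne₃ (edge_ext C (hr hc) he₃)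
  rw [Prod.Lex.toLex_le_toLex] at h₂ h₃
  simp only [he₂, he₃] at h₂ h₃
  refine ⟨e₂, e₃, ⟨e, he₂.symm, he₃.symm, ?_, ?_⟩, ?_⟩
  · rw [he₂]; omega
  · rw [he₃]; omega
  · exact single_add_single_le (fun h23 => hne₂ (edge_ext C he₂ (h23 ▸ he₃)))
      (by omega) (by omega)

lemma exists_crossing_of_degVec_eq [Finite G.edgeSet] (hr : Function.Injective r)
    {d d' : G.edgeSet →₀ ℕ} (h : degVec G d = degVec G d') (hne : d ≠ d') :
    ∃ e₂ e₃, IsCrossing C r e₂ e₃ ∧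
      (Finsupp.single e₂ 1 + Finsupp.single e₃ 1 ≤ d ∨
        Finsupp.single e₂ 1 + Finsupp.single e₃ 1 ≤ d') := by
  classical
  obtain ⟨e₀, he₀⟩ := Finsupp.ne_iff.1 hne
  obtain ⟨e, he, hmin⟩ := Set.exists_min_image {e | d e ≠ d' e}
    (fun e => toLex (r (rowEnd C e), r (colEnd C e))) (Set.toFinite _) ⟨e₀, he₀⟩
  rcases lt_or_gt_of_ne (he : d e ≠ d' e) with hlt | hlt
  · obtain ⟨e₂, e₃, hc, hle⟩ := exists_crossing_of_lt hr h.symm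
      (fun e' he' => hmin e' he'.symm) hlt
    exact ⟨e₂, e₃, hc, Or.inl hle⟩
  · obtain ⟨e₂, e₃, hc, hle⟩ := exists_crossing_of_lt hr h hmin hlt
    exact ⟨e₂, e₃, hc, Or.inr hle⟩

/-- A lexicographic order for which the variable with the smallest key is the largest one. -/
lemma exists_monomialOrder_of_key {σ : Type uv} [Finite σ] {ι : Type*} [LinearOrder ι]
    (key : σ → ι) (hkey : Function.Injective key) :
    ∃ m : MonomialOrder.{uv, uv} σ, ∀ e₁ e₂ e₃ e₄ : σ,
      key e₂ < key e₁ → key e₂ < key e₃ → key e₂ < key e₄ →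
      m.toSyn (Finsupp.single e₁ 1 + Finsupp.single e₄ 1)
        < m.toSyn (Finsupp.single e₂ 1 + Finsupp.single e₃ 1) := by
  classical
  let _ : LinearOrder σ := LinearOrder.lift' key hkey
  have _ : WellFoundedGT σ := Finite.to_wellFoundedGT
  refine ⟨MonomialOrder.lex, fun e₁ e₂ e₃ e₄ h21 h23 h24 => ?_⟩
  change e₂ < e₁ at h21
  change e₂ < e₃ at h23
  change e₂ < e₄ at h24
  rw [MonomialOrder.lex_lt_iff, Finsupp.Lex.lt_iff]
  refine ⟨e₂, fun e he => ?_, ?_⟩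
  · have n1 := (he.trans h21).ne'
    have n3 := (he.trans h23).ne'
    have n4 := (he.trans h24).ne'
    simp [n1, n3, n4, he.ne']
  · simp [h21.ne', h23.ne', h24.ne']

lemma exists_lex_monomialOrder [Finite G.edgeSet] (C : G.Coloring (Fin 2))
    (hr : Function.Injective r) :
    ∃ m : MonomialOrder.{uv, uv} G.edgeSet, ∀ e₂ e₃ e₁ e₄ : G.edgeSet,
      rowEnd C e₁ = rowEnd C e₂ → r (rowEnd C e₂) < r (rowEnd C e₃) →
      rowEnd C e₄ = rowEnd C e₃ → r (colEnd C e₁) < r (colEnd C e₂) →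
      m.toSyn (Finsupp.single e₁ 1 + Finsupp.single e₄ 1)
        < m.toSyn (Finsupp.single e₂ 1 + Finsupp.single e₃ 1) := by
  let key : G.edgeSet → ℕ ×ₗ ℕᵒᵈ := fun e =>
    toLex (r (rowEnd C e), OrderDual.toDual (r (colEnd C e)))
  have hkey : Function.Injective key := by
    intro e e' h
    have h' := congrArg ofLex h
    simp only [key, ofLex_toLex, Prod.mk.injEq] at h'
    exact edge_ext C (hr h'.1) (hr (OrderDual.toDual.injective h'.2))
  obtain ⟨m, hm⟩ := exists_monomialOrder_of_key key hkey
  refine ⟨m, fun e₂ e₃ e₁ e₄ h₁ h₃ h₄ hc => hm e₁ e₂ e₃ e₄ ?_ ?_ ?_⟩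
  · rw [Prod.Lex.toLex_lt_toLex]
    exact Or.inr ⟨by simp [h₁], OrderDual.toDual_lt_toDual.2 hc⟩
  · rw [Prod.Lex.toLex_lt_toLex]
    exact Or.inl h₃
  · rw [Prod.Lex.toLex_lt_toLex]
    exact Or.inl (by simpa [h₄] using h₃)

theorem hasQuadraticGB_of_isGammaFree [Finite V] (K : Type*) [Field K] (C : G.Coloring (Fin 2))
    (hr : Function.Injective r) (hC : IsGammaFree G C r) : HasQuadraticGB (toricIdeal K G) := by
  classical
  obtain ⟨m, hm⟩ := exists_lex_monomialOrder C hr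
  set T : Set (G.edgeSet →₀ ℕ) :=
    {t | ∃ e₂ e₃, IsCrossing C r e₂ e₃ ∧ t = Finsupp.single e₂ 1 + Finsupp.single e₃ 1} with hT
  have uncross : ∀ t ∈ T, ∃ t', degVec G t' = degVec G t ∧ m.toSyn t' < m.toSyn t := by
    rintro _ ⟨e₂, e₃, ⟨e₁, h12, h13, hrow, hcol⟩, rfl⟩
    obtain ⟨e₄, h43, h42⟩ := exists_edge_of_adj C (color_rowEnd C e₃)
      (hC (rowEnd C e₂) (rowEnd C e₃) (colEnd C e₃) (colEnd C e₂)
        (color_rowEnd C e₂) (color_rowEnd C e₃) hrow hcol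
        (h12 ▸ h13 ▸ adj_rowEnd_colEnd C e₁) (adj_rowEnd_colEnd C e₂) (adj_rowEnd_colEnd C e₃))
    refine ⟨Finsupp.single e₁ 1 + Finsupp.single e₄ 1, ?_,
      hm e₂ e₃ e₁ e₄ h12 hrow h43 (h13 ▸ hcol)⟩
    simp only [map_add, degVec_single, edgeVec_edge C, h12, h13, h43, h42]
    abel
  refine ⟨m, (fun d => monomial d (1 : K)) '' T, le_antisymm ?_ ?_, ?_⟩
  · rw [initialIdeal_eq_span_image, Ideal.span_le]
    rintro _ ⟨d, ⟨f, hf, hd, hmax⟩, rfl⟩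
    rw [SetLike.mem_coe, monomial_mem_span_image_iff]
    obtain ⟨d', hd', hne, hdeg⟩ := exists_ne_of_mem_toricIdeal K G hf hd
    have hlt : m.toSyn d' < m.toSyn d :=
      lt_of_le_of_ne (hmax d' hd') fun h => hne (m.toSyn.injective h)
    obtain ⟨d₀, hd₀, hmin⟩ := (InvImage.wf m.toSyn (wellFounded_lt (α := m.syn))).has_min
      {t | degVec G t = degVec G d} ⟨d, rfl⟩
    have hne₀ : d ≠ d₀ := by
      rintro rfl
      exact hmin d' hdeg hlt
    obtain ⟨e₂, e₃, hc, hle | hle⟩ :=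
      exists_crossing_of_degVec_eq (C := C) hr (Eq.symm hd₀) hne₀
    · exact ⟨_, ⟨e₂, e₃, hc, rfl⟩, hle⟩
    · obtain ⟨t', hdeg', hlt'⟩ := uncross _ ⟨e₂, e₃, hc, rfl⟩
      obtain ⟨u, rfl⟩ := exists_add_of_le hle
      refine absurd ?_ (hmin (t' + u) ?_)
      · simp only [InvImage, map_add] at hlt' ⊢
        exact add_lt_add_left hlt' _
      · rw [Set.mem_ofPred_eq, ← (hd₀ : _ = _), map_add, map_add, hdeg']
  · rw [initialIdeal_eq_span_image]
    refine Ideal.span_mono (Set.image_mono fun t ht => ?_)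
    obtain ⟨t', hdeg, hlt⟩ := uncross t ht
    refine mem_leadingExponents_of_degVec_eq hdeg.symm ?_ hlt.le
    rintro rfl
    exact lt_irrefl _ hlt
  · rintro _ ⟨_, ⟨e₂, e₃, -, rfl⟩, rfl⟩
    exact ⟨e₂, e₃, (X_mul_X_eq_monomial e₂ e₃).symm⟩

end GammaFree

/-! ### Doubly lexical orderings -/

section DoublyLexical

variable {V : Type*} (G : SimpleGraph V)

/-- An ordering `r` of the vertices such that, of two vertices of the same colour, the larger one
has the colexicographically larger neighbourhood: the largest vertex adjacent to exactly one of
them, if there is any, is adjacent to the larger one. -/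
def IsDoublyLexical {V α : Type*} (G : SimpleGraph V) (C : V → α) (r : V → ℕ) : Prop :=
  ∀ x y : V, C x = C y → r x < r y → ∀ b, G.Adj x b → ¬ G.Adj y b →
    ∃ b', G.Adj y b' ∧ ¬ G.Adj x b' ∧ r b < r b' ∧
      ∀ v, (G.Adj x v ∧ ¬ G.Adj y v) ∨ (G.Adj y v ∧ ¬ G.Adj x v) → r v ≤ r b'

variable {G} [Fintype V] [DecidableEq V] [DecidableRel G.Adj]

open Matrix in
lemma dotProduct_mulVec_swap (w : V → ℤ) {x y : V} (hxy : ¬ G.Adj x y) :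
    (w ∘ Equiv.swap x y) ⬝ᵥ (G.adjMatrix ℤ *ᵥ (w ∘ Equiv.swap x y))
      = w ⬝ᵥ (G.adjMatrix ℤ *ᵥ w)
        + 2 * (w y - w x) * ((G.adjMatrix ℤ *ᵥ w) x - (G.adjMatrix ℤ *ᵥ w) y) := by
  have hw : w ∘ Equiv.swap x y = w + (w y - w x) • (Pi.single x 1 - Pi.single y 1) := by
    funext v
    by_cases hvx : v = x
    · subst hvx
      by_cases hvy : v = y
      · subst hvy; simp
      · simp [hvy]
    · by_cases hvy : v = y
      · subst hvy; simp [hvx]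
      · simp [Equiv.swap_apply_of_ne_of_ne hvx hvy, hvx, hvy]
  have hsymm : ∀ u : V → ℤ, w ⬝ᵥ (G.adjMatrix ℤ *ᵥ u) = u ⬝ᵥ (G.adjMatrix ℤ *ᵥ w) := by
    intro u
    rw [dotProduct_mulVec, ← mulVec_transpose, SimpleGraph.transpose_adjMatrix, dotProduct_comm]
  have hyx : ¬ G.Adj y x := fun h => hxy h.symm
  rw [hw, mulVec_add, add_dotProduct, dotProduct_add, dotProduct_add,
    hsymm ((w y - w x) • (Pi.single x 1 - Pi.single y 1)), mulVec_smul,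
    smul_dotProduct, smul_dotProduct, dotProduct_smul]
  simp only [sub_dotProduct, mulVec_sub, dotProduct_sub, single_dotProduct, mulVec_single,
    Pi.smul_apply, smul_eq_mul]
  simp [hxy, hyx]
  ring

open Matrix in
lemma exists_isDoublyLexical {α : Type*} (C : G.Coloring α) :
    ∃ r : V → ℕ, Function.Injective r ∧ (∀ v, r v < Fintype.card V) ∧
      IsDoublyLexical G C r := by
  let w : (V ≃ Fin (Fintype.card V)) → V → ℤ := fun σ v => 2 ^ (σ v : ℕ)
  let F : (V ≃ Fin (Fintype.card V)) → ℤ := fun σ => w σ ⬝ᵥ (G.adjMatrix ℤ *ᵥ w σ)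
  have : Nonempty (V ≃ Fin (Fintype.card V)) := ⟨Fintype.equivFin V⟩
  obtain ⟨σ, hσ⟩ := Finite.exists_max F
  have hinj : Function.Injective fun v => (σ v : ℕ) := fun u v h => σ.injective (Fin.ext h)
  refine ⟨fun v => σ v, hinj, fun v => (σ v).2, fun x y hC hlt b hxb hyb => ?_⟩
  have hxy : ¬ G.Adj x y := fun h => C.valid h hC
  have hswap : F ((Equiv.swap x y).trans σ) ≤ F σ := hσ _
  have hw : w ((Equiv.swap x y).trans σ) = w σ ∘ Equiv.swap x y := rfl
  simp only [F] at hswap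
  rw [hw, dotProduct_mulVec_swap _ hxy] at hswap
  have hwlt : w σ x < w σ y := pow_lt_pow_right₀ (by norm_num) hlt
  have hle : (G.adjMatrix ℤ *ᵥ w σ) x ≤ (G.adjMatrix ℤ *ᵥ w σ) y := by nlinarith
  have hsum : ∀ v, (G.adjMatrix ℤ *ᵥ w σ) v
      = ((∑ k ∈ (G.neighborFinset v).image fun u => (σ u : ℕ), 2 ^ k : ℕ) : ℤ) := by
    intro v
    rw [SimpleGraph.adjMatrix_mulVec_apply, Finset.sum_image hinj.injOn]
    push_cast
    rfl
  rw [hsum, hsum, Nat.cast_le, Finset.geomSum_le_geomSum_iff_toColex_le_toColex le_rfl,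
    Finset.Colex.toColex_le_toColex] at hle
  have hmem : ∀ u v : V, (σ u : ℕ) ∈ (G.neighborFinset v).image (fun u => (σ u : ℕ))
      ↔ G.Adj v u := by
    intro u v
    rw [hinj.mem_finset_image, SimpleGraph.mem_neighborFinset]
  have key : ∀ v, G.Adj x v → ¬ G.Adj y v →
      ∃ u, G.Adj y u ∧ ¬ G.Adj x u ∧ (σ v : ℕ) ≤ σ u := by
    intro v hxv hyv
    obtain ⟨k, hk, hk', hvk⟩ := hle ((hmem v x).2 hxv) fun h => hyv ((hmem v y).1 h)
    obtain ⟨u, hu, rfl⟩ := Finset.mem_image.1 hk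
    exact ⟨u, (hmem u y).1 hk, fun h => hk' ((hmem u x).2 h), hvk⟩
  obtain ⟨u, hyu, hxu, hbu⟩ := key b hxb hyb
  obtain ⟨b', ⟨hyb', hxb'⟩, hmax⟩ := Set.exists_max_image {v | G.Adj y v ∧ ¬ G.Adj x v}
    (fun v => (σ v : ℕ)) (Set.toFinite _) ⟨u, hyu, hxu⟩
  refine ⟨b', hyb', hxb', lt_of_le_of_ne (hbu.trans (hmax u ⟨hyu, hxu⟩)) fun h => ?_, ?_⟩
  · exact hyb (hinj h ▸ hyb')
  · rintro v (⟨hxv, hyv⟩ | hv)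
    · obtain ⟨u', hyu', hxu', hvu'⟩ := key v hxv hyv
      exact hvu'.trans (hmax u' ⟨hyu', hxu'⟩)
    · exact hmax v hv

end DoublyLexical

/-! ### Growing a chordless path from a forbidden submatrix -/

section Chain

variable {V : Type*} {G : SimpleGraph V}

/-- Every cycle of length at least `6` has a chord. -/
def IsChordal6 (G : SimpleGraph V) : Prop :=
  ∀ (q : ℕ) (c : ZMod q → V), IsCycleOn' G q c → 6 ≤ q → ∃ e, IsChord G q c e

/-- The induced cycle `a₀, b₁, a₂, b₃, …, a₃, b₂, a₁, b₀` of length `2 m + 2`. -/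
lemma not_isChordal6_of_closed_chain {α : Type*} (C : G.Coloring α) {a b : ℕ → V} {m : ℕ}
    (hm : 2 ≤ m)
    (ha : ∀ i ≤ m, ∀ j ≤ m, a i = a j → i = j) (hb : ∀ i ≤ m, ∀ j ≤ m, b i = b j → i = j)
    (hCa : ∀ i ≤ m, C (a i) = C (a 0)) (hCb : ∀ i ≤ m, C (b i) = C (b 0))
    (hab : ∀ i ≤ m, ∀ j ≤ m, G.Adj (a i) (b j) ↔
      (i = 0 ∧ j = 0) ∨ i = j + 1 ∨ j = i + 1 ∨ (i = m ∧ j = m)) :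
    ¬ IsChordal6 G := by
  intro hch
  have hC : C (a 0) ≠ C (b 0) := C.valid ((hab 0 (by omega) 0 (by omega)).2 (by simp))
  have hne : ∀ i ≤ m, ∀ j ≤ m, a i ≠ b j := by
    intro i hi j hj h
    exact hC (by rw [← hCa i hi, h, hCb j hj])
  have haa : ∀ i ≤ m, ∀ j ≤ m, ¬ G.Adj (a i) (a j) := fun i hi j hj h =>
    C.valid h ((hCa i hi).trans (hCa j hj).symm)
  have hbb : ∀ i ≤ m, ∀ j ≤ m, ¬ G.Adj (b i) (b j) := fun i hi j hj h =>
    C.valid h ((hCb i hi).trans (hCb j hj).symm)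
  let idx : ℕ → ℕ := fun p => min p (2 * m + 1 - p)
  have hidx : ∀ p, idx p ≤ m := fun p => by simp only [idx]; omega
  let f : ℕ → V := fun p => if p % 2 = 0 then a (idx p) else b (idx p)
  let c : ZMod (2 * m + 2) → V := fun z => f z.val
  have hval : ∀ z : ZMod (2 * m + 2), z.val < 2 * m + 2 := fun z => z.val_lt
  have hsucc : ∀ z : ZMod (2 * m + 2), (z + 1).val = (z.val + 1) % (2 * m + 2) := by
    intro z
    rw [ZMod.val_add, ZMod.val_one_eq_one_mod, Nat.mod_eq_of_lt (by omega : 1 < 2 * m + 2)]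
  have hfadj : ∀ p q, p < 2 * m + 2 → q < 2 * m + 2 → p % 2 = 0 → q % 2 = 1 →
      (G.Adj (f p) (f q) ↔ q = (p + 1) % (2 * m + 2) ∨ p = (q + 1) % (2 * m + 2)) := by
    intro p q hp hq hp2 hq2
    simp only [f, hp2, hq2, if_true, one_ne_zero, if_false]
    rw [hab _ (hidx p) _ (hidx q)]
    have e1 : (p + 1) % (2 * m + 2) = p + 1 := Nat.mod_eq_of_lt (by omega)
    rw [e1]
    rcases Nat.lt_or_ge (q + 1) (2 * m + 2) with h | h
    · rw [Nat.mod_eq_of_lt h]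
      simp only [idx]
      omega
    · have : q + 1 = 2 * m + 2 := by omega
      rw [this, Nat.mod_self]
      simp only [idx]
      omega
  have hcyc : IsCycleOn' G (2 * m + 2) c := by
    refine ⟨by omega, fun z z' h => ZMod.val_injective _ ?_, fun z => ?_⟩
    · have h1 := hval z
      have h2 := hval z'
      simp only [c, f] at h
      split_ifs at h with p1 p2 p2
      · have := ha _ (hidx _) _ (hidx _) h
        simp only [idx] at this
        omega
      · exact absurd h (hne _ (hidx _) _ (hidx _))
      · exact absurd h.symm (hne _ (hidx _) _ (hidx _))
      · have := hb _ (hidx _) _ (hidx _) h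
        simp only [idx] at this
        omega
    · have h1 := hval z
      have h2 := hval (z + 1)
      have h3 := hsucc z
      have h4 : (z.val + 1) % (2 * m + 2) = z.val + 1 ∨ (z.val = 2 * m + 1 ∧
          (z.val + 1) % (2 * m + 2) = 0) := by
        rcases Nat.lt_or_ge (z.val + 1) (2 * m + 2) with h | h
        · exact Or.inl (Nat.mod_eq_of_lt h)
        · have : z.val + 1 = 2 * m + 2 := by omega
          exact Or.inr ⟨by omega, by rw [this, Nat.mod_self]⟩
      rcases Nat.mod_two_eq_zero_or_one z.val with hz | hz
      · exact (hfadj _ _ h1 h2 hz (by omega)).2 (Or.inl h3)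
      · exact ((hfadj _ _ h2 h1 (by omega) hz).2 (Or.inr h3)).symm
  obtain ⟨e, heG, hecyc, i, j, rfl⟩ := hch _ c hcyc (by omega)
  have main : ∀ i j : ZMod (2 * m + 2), i.val % 2 = 0 → j.val % 2 = 1 → G.Adj (c i) (c j) →
      s(c i, c j) ∈ cycEdges (2 * m + 2) c := by
    intro i j hi hj hadj
    rcases (hfadj _ _ (hval i) (hval j) hi hj).1 hadj with h | h
    · rw [← hsucc] at h
      exact ⟨i, by rw [ZMod.val_injective _ h]⟩
    · rw [← hsucc] at h
      exact ⟨j, by rw [ZMod.val_injective _ h, Sym2.eq_swap]⟩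
  have hadj : G.Adj (c i) (c j) := heG
  rcases Nat.mod_two_eq_zero_or_one i.val with hi | hi <;>
    rcases Nat.mod_two_eq_zero_or_one j.val with hj | hj
  · simp only [c, f, hi, hj, if_true] at hadj
    exact haa _ (hidx _) _ (hidx _) hadj
  · exact hecyc (main i j hi hj hadj)
  · exact hecyc (Sym2.eq_swap ▸ main j i hj hi hadj.symm)
  · simp only [c, f, hi, hj, one_ne_zero, if_false] at hadj
    exact hbb _ (hidx _) _ (hidx _) hadj

/-- One half of the data of an induced path `…, a₃, b₂, a₁, b₀, a₀, b₁, a₂, b₃, …` in which both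
sequences increase and each `b (i + 2)` is the largest vertex adjacent to exactly one of `a i`
and `a (i + 1)`. -/
structure IsHalfChain {α : Type*} (G : SimpleGraph V) (C : V → α) (r : V → ℕ) (a b : ℕ → V)
    (k : ℕ) : Prop where
  color : ∀ i ≤ k, C (b i) = C (b 0)
  strictMono : ∀ i j, i < j → j ≤ k → r (b i) < r (b j)
  adj_iff : ∀ i ≤ k, ∀ j ≤ k, G.Adj (a i) (b j) ↔ (i = 0 ∧ j = 0) ∨ i = j + 1 ∨ j = i + 1
  le_of_separates : ∀ i, i + 2 ≤ k → ∀ v,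
    (G.Adj (a i) v ∧ ¬ G.Adj (a (i + 1)) v) ∨ (G.Adj (a (i + 1)) v ∧ ¬ G.Adj (a i) v) →
      r v ≤ r (b (i + 2))

variable {α : Type*} {C : G.Coloring α} {r : V → ℕ} {a b : ℕ → V} {k : ℕ}

lemma IsHalfChain.exists_next (hr : IsDoublyLexical G C r)
    (hab : IsHalfChain G C r a b k) (hba : IsHalfChain G C r b a k) (hk : 1 ≤ k) :
    ∃ y, r (b k) < r y ∧ G.Adj (a k) y ∧ (∀ i < k, ¬ G.Adj (a i) y) ∧
      ∀ v, (G.Adj (a (k - 1)) v ∧ ¬ G.Adj (a k) v) ∨ (G.Adj (a k) v ∧ ¬ G.Adj (a (k - 1)) v) →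
        r v ≤ r y := by
  obtain ⟨y, hky, hky', hlt, hmax⟩ := hr (a (k - 1)) (a k)
    ((hba.color _ (by omega)).trans (hba.color k le_rfl).symm)
    (hba.strictMono _ _ (by omega) le_rfl) (b k)
    ((hab.adj_iff _ (by omega) k le_rfl).2 (by omega))
    fun h => by have := (hab.adj_iff k le_rfl k le_rfl).1 h; omega
  refine ⟨y, hlt, hky, fun i hi => ?_, hmax⟩
  have aux : ∀ j, j < k → ¬ G.Adj (a (k - 1 - j)) y := by
    intro j
    induction j with
    | zero => exact fun _ => hky'
    | succ j ih =>
      intro hj h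
      have hi : k - 1 - j = k - 1 - (j + 1) + 1 := by omega
      have hle := hab.le_of_separates (k - 1 - (j + 1)) (by omega) y
        (Or.inl ⟨h, hi ▸ ih (by omega)⟩)
      rcases (show k - 1 - (j + 1) + 2 ≤ k by omega).lt_or_eq with hlt' | heq
      · have := hab.strictMono _ _ hlt' le_rfl
        omega
      · rw [heq] at hle
        omega
  have := aux (k - 1 - i) (by omega)
  rwa [show k - 1 - (k - 1 - i) = i by omega] at this

/-- Append a term to the first `k + 1` terms of a sequence. -/
def appendTerm (a : ℕ → V) (k : ℕ) (x : V) : ℕ → V := fun i => if i ≤ k then a i else x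

lemma appendTerm_of_le {x : V} {i : ℕ} (hi : i ≤ k) : appendTerm a k x i = a i := if_pos hi

lemma appendTerm_succ {x : V} : appendTerm a k x (k + 1) = x := if_neg (by omega)

lemma IsHalfChain.append (hab : IsHalfChain G C r a b k) (hba : IsHalfChain G C r b a k)
    (hk : 1 ≤ k) {x y : V} (hxy : ¬ G.Adj x y) (hC : C y = C (b 0))
    (hlt : r (b k) < r y) (hy : ∀ i ≤ k, G.Adj (a i) y ↔ i = k)
    (hx : ∀ i ≤ k, G.Adj (b i) x ↔ i = k)
    (hmax : ∀ v, (G.Adj (a (k - 1)) v ∧ ¬ G.Adj (a k) v) ∨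
      (G.Adj (a k) v ∧ ¬ G.Adj (a (k - 1)) v) → r v ≤ r y) :
    IsHalfChain G C r (appendTerm a k x) (appendTerm b k y) (k + 1) where
  color i hi := by
    rw [appendTerm_of_le (Nat.zero_le k)]
    rcases hi.lt_or_eq with hi | rfl
    · rw [appendTerm_of_le (by omega), hab.color i (by omega)]
    · rw [appendTerm_succ, hC]
  strictMono i j hij hj := by
    rw [appendTerm_of_le (by omega : i ≤ k)]
    rcases hj.lt_or_eq with hj | rfl
    · rw [appendTerm_of_le (by omega)]
      exact hab.strictMono i j hij (by omega)
    · rw [appendTerm_succ]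
      rcases (show i ≤ k by omega).lt_or_eq with h | rfl
      · exact (hab.strictMono i k h le_rfl).trans hlt
      · exact hlt
  adj_iff i hi j hj := by
    rcases hi.lt_or_eq with hi | rfl
    · rw [appendTerm_of_le (by omega)]
      rcases hj.lt_or_eq with hj | rfl
      · rw [appendTerm_of_le (by omega), hab.adj_iff i (by omega) j (by omega)]
      · rw [appendTerm_succ, hy i (by omega)]
        omega
    · rw [appendTerm_succ]
      rcases hj.lt_or_eq with hj | rfl
      · rw [appendTerm_of_le (by omega), G.adj_comm, hx j (by omega)]
        omega
      · rw [appendTerm_succ]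
        refine iff_of_false hxy (by omega)
  le_of_separates i hi v hv := by
    rw [appendTerm_of_le (by omega : i ≤ k), appendTerm_of_le (by omega : i + 1 ≤ k)] at hv
    rcases hi.lt_or_eq with hi | hi
    · rw [appendTerm_of_le (by omega)]
      exact hab.le_of_separates i (by omega) v hv
    · rw [hi, appendTerm_succ]
      obtain rfl : k = i + 1 := by omega
      exact hmax v hv

lemma exists_isHalfChain_succ {C : G.Coloring (Fin 2)} (hch : IsChordal6 G)
    (hr : IsDoublyLexical G C r) (hk : 1 ≤ k)
    (hab : IsHalfChain G C r a b k) (hba : IsHalfChain G C r b a k) :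
    ∃ a' b', IsHalfChain G C r a' b' (k + 1) ∧ IsHalfChain G C r b' a' (k + 1) := by
  obtain ⟨y, hlty, hadjy, hnady, hmaxy⟩ := hab.exists_next hr hba hk
  obtain ⟨x, hltx, hadjx, hnadx, hmaxx⟩ := hba.exists_next hr hab hk
  have hy : ∀ i ≤ k, G.Adj (a i) y ↔ i = k := fun i hi =>
    ⟨fun h => by by_contra hne; exact hnady i (by omega) h, fun h => h ▸ hadjy⟩
  have hx : ∀ i ≤ k, G.Adj (b i) x ↔ i = k := fun i hi =>
    ⟨fun h => by by_contra hne; exact hnadx i (by omega) h, fun h => h ▸ hadjx⟩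
  have hC0 : C (a 0) ≠ C (b 0) :=
    C.valid ((hab.adj_iff 0 (Nat.zero_le k) 0 (Nat.zero_le k)).2 (by simp))
  have hCy : C y = C (b 0) := by
    have h := C.valid hadjy
    rw [hba.color k le_rfl] at h
    omega
  have hCx : C x = C (a 0) := by
    have h := C.valid hadjx
    rw [hab.color k le_rfl] at h
    omega
  have hxy : ¬ G.Adj x y := by
    intro hxy
    have hinj : ∀ {u : ℕ → V} {z : V}, (∀ i j, i < j → j ≤ k → r (u i) < r (u j)) →
        r (u k) < r z → ∀ i ≤ k + 1, ∀ j ≤ k + 1,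
        appendTerm u k z i = appendTerm u k z j → i = j := by
      intro u z hmono hz
      have hlt : ∀ i j, i < j → j ≤ k + 1 → appendTerm u k z i ≠ appendTerm u k z j := by
        intro i j hij hj h
        rw [appendTerm_of_le (by omega : i ≤ k)] at h
        rcases hj.lt_or_eq with hj | rfl
        · rw [appendTerm_of_le (by omega)] at h
          have := hmono i j hij (by omega)
          rw [h] at this
          omega
        · rw [appendTerm_succ] at h
          rcases (show i ≤ k by omega).lt_or_eq with h' | rfl
          · have := hmono i k h' le_rfl
            rw [h] at this
            omega
          · rw [h] at hz
            omega
      intro i hi j hj h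
      rcases lt_trichotomy i j with hij | hij | hij
      · exact absurd h (hlt i j hij hj)
      · exact hij
      · exact absurd h.symm (hlt j i hij hi)
    refine not_isChordal6_of_closed_chain C (m := k + 1) (a := appendTerm a k x)
      (b := appendTerm b k y) (by omega) (hinj hba.strictMono hltx) (hinj hab.strictMono hlty)
      ?_ ?_ ?_ hch
    · intro i hi
      rw [appendTerm_of_le (Nat.zero_le k)]
      rcases hi.lt_or_eq with hi | rfl
      · rw [appendTerm_of_le (by omega), hba.color i (by omega)]
      · rw [appendTerm_succ, hCx]
    · intro i hi
      rw [appendTerm_of_le (Nat.zero_le k)]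
      rcases hi.lt_or_eq with hi | rfl
      · rw [appendTerm_of_le (by omega), hab.color i (by omega)]
      · rw [appendTerm_succ, hCy]
    · intro i hi j hj
      rcases hi.lt_or_eq with hi | rfl
      · rw [appendTerm_of_le (by omega)]
        rcases hj.lt_or_eq with hj | rfl
        · rw [appendTerm_of_le (by omega), hab.adj_iff i (by omega) j (by omega)]
          omega
        · rw [appendTerm_succ, hy i (by omega)]
          omega
      · rw [appendTerm_succ]
        rcases hj.lt_or_eq with hj | rfl
        · rw [appendTerm_of_le (by omega), G.adj_comm, hx j (by omega)]
          omega
        · rw [appendTerm_succ]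
          exact iff_of_true hxy (by omega)
  exact ⟨_, _, hab.append hba hk hxy hCy hlty hy hx hmaxy,
    hba.append hab hk (fun h => hxy h.symm) hCx hltx hx hy hmaxx⟩

theorem IsDoublyLexical.isGammaFree {V : Type uv} {G : SimpleGraph V} {C : G.Coloring (Fin 2)}
    {r : V → ℕ} {n : ℕ} (hrn : ∀ v, r v < n) (hr : IsDoublyLexical G C r)
    (hch : IsChordal6 G) : IsGammaFree G C r := by
  intro a a' b b' hCa hCa' hlta hltb hab hab' ha'b
  by_contra hno
  have hCb : C b ≠ 0 := fun h => C.valid hab (hCa.trans h.symm)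
  have hCb' : C b' ≠ 0 := fun h => C.valid hab' (hCa.trans h.symm)
  have hchain : ∀ k, 1 ≤ k →
      ∃ u v, IsHalfChain G C r u v k ∧ IsHalfChain G C r v u k := by
    intro k hk
    induction k, hk using Nat.le_induction with
    | base =>
      refine ⟨fun i => if i = 0 then a else a', fun i => if i = 0 then b else b', ?_, ?_⟩
      · refine ⟨fun i hi => ?_, fun i j hij hj => ?_, fun i hi j hj => ?_, fun i hi => by omega⟩
        · split_ifs <;> omega
        · obtain rfl : i = 0 := by omega
          obtain rfl : j = 1 := by omega
          simpa using hltb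
        · interval_cases i <;> interval_cases j <;> simp [hab, hab', ha'b, hno]
      · refine ⟨fun i hi => ?_, fun i j hij hj => ?_, fun i hi j hj => ?_, fun i hi => by omega⟩
        · split_ifs <;> omega
        · obtain rfl : i = 0 := by omega
          obtain rfl : j = 1 := by omega
          simpa using hlta
        · rw [G.adj_comm]
          interval_cases i <;> interval_cases j <;> simp [hab, hab', ha'b, hno]
    | succ k hk ih =>
      obtain ⟨u, v, huv, hvu⟩ := ih
      exact exists_isHalfChain_succ hch hr hk huv hvu
  obtain ⟨u, v, huv, -⟩ := hchain (n + 1) (by omega)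
  have hge : ∀ i ≤ n + 1, i ≤ r (v i) := by
    intro i
    induction i with
    | zero => omega
    | succ i ih =>
      intro hi
      have := huv.strictMono i (i + 1) (by omega) hi
      have := ih (by omega)
      omega
  have := hge (n + 1) le_rfl
  have := hrn (v (n + 1))
  omega

end Chain

/-! ### Chordless cycles obstruct quadratic Gröbner bases -/

section Cycle

variable {V : Type uv} {G : SimpleGraph V} {q : ℕ} {c : ZMod q → V}

lemma ZMod.natCast_ne_zero_of_lt {n : ℕ} (hn : n ≠ 0) (hnq : n < q) : (n : ZMod q) ≠ 0 := by
  rw [Ne, ZMod.natCast_eq_zero_iff]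
  exact fun h => absurd (Nat.le_of_dvd (Nat.pos_of_ne_zero hn) h) (by omega)

lemma ZMod.add_natCast_ne_self {n : ℕ} (hn : n ≠ 0) (hnq : n < q) (i : ZMod q) : i + n ≠ i := by
  simpa using ZMod.natCast_ne_zero_of_lt hn hnq

/-- The `i`-th edge of a cycle. -/
def cycEdge (hc : IsCycleOn' G q c) (i : ZMod q) : G.edgeSet :=
  ⟨s(c i, c (i + 1)), hc.2.2 i⟩

variable (hc : IsCycleOn' G q c)

lemma mem_cycEdge_iff {i j : ZMod q} : c j ∈ (cycEdge hc i).1 ↔ j = i ∨ j = i + 1 := by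
  simp [cycEdge, hc.2.1.eq_iff]

lemma cycEdge_injective : Function.Injective (cycEdge hc) := by
  intro i j h
  rcases (mem_cycEdge_iff hc).1 (h ▸ (mem_cycEdge_iff hc).2 (Or.inl rfl) :
    c i ∈ (cycEdge hc j).1) with h1 | h1
  · exact h1
  · rcases (mem_cycEdge_iff hc).1 (h ▸ (mem_cycEdge_iff hc).2 (Or.inr rfl) :
      c (i + 1) ∈ (cycEdge hc j).1) with h2 | h2
    · refine absurd ?_ (ZMod.add_natCast_ne_self (n := 2) (by simp) (by have := hc.1; omega) j)
      rw [h1] at h2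
      push_cast
      linear_combination h2
    · exact add_right_cancel h2

lemma edgeVec_cycEdge (i : ZMod q) :
    edgeVec (cycEdge hc i).1 = Finsupp.single (c i) 1 + Finsupp.single (c (i + 1)) 1 := rfl

/-- Two edges of the same class of a chordless cycle of length at least `6` form the only
matching on their endpoints. -/
lemma eq_of_degVec_eq_cycEdge_add_cycEdge {α : Type*} (C : G.Coloring α) (hq : 6 ≤ q)
    (hchord : ¬ ∃ e, IsChord G q c e) {p p' : ZMod q} (hp : p ≠ p') (hC : C (c p) = C (c p'))
    {d : G.edgeSet →₀ ℕ}
    (hd : degVec G d = edgeVec (cycEdge hc p).1 + edgeVec (cycEdge hc p').1) :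
    d = Finsupp.single (cycEdge hc p) 1 + Finsupp.single (cycEdge hc p') 1 := by
  classical
  have hsub : ∀ v, degVec G d v ≠ 0 → v = c p ∨ v = c (p + 1) ∨ v = c p' ∨ v = c (p' + 1) := by
    intro v hv
    by_contra! h
    apply hv
    simp [hd, edgeVec_cycEdge, h.1.symm, h.2.1.symm, h.2.2.1.symm, h.2.2.2.symm]
  have hcyc : ∀ e, d e ≠ 0 → ∃ s, e = cycEdge hc s := by
    intro e he
    have hmem : ∀ v ∈ e.1, ∃ i, v = c i := by
      intro v hv
      rcases hsub v (degVec_apply_ne_zero he hv) with h | h | h | h <;> exact ⟨_, h⟩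
    obtain ⟨⟨e, heG⟩, he'⟩ : ∃ e', e' = e := ⟨e, rfl⟩
    by_contra! hne
    refine hchord ⟨e, heG, fun ⟨s, hs⟩ => hne s (by rw [← he']; exact Subtype.ext hs), ?_⟩
    subst he'
    induction e with
    | _ x y =>
      obtain ⟨i, rfl⟩ := hmem x (Sym2.mem_mk_left _ _)
      obtain ⟨j, rfl⟩ := hmem y (Sym2.mem_mk_right _ _)
      exact ⟨i, j, rfl⟩
  have h1 : ∀ i : ZMod q, i + 1 ≠ i := by
    simpa using ZMod.add_natCast_ne_self (q := q) (n := 1) (by simp) (by omega)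
  have h2 : ∀ i : ZMod q, i + 2 ≠ i := by
    simpa using ZMod.add_natCast_ne_self (q := q) (n := 2) (by simp) (by omega)
  have h4 : ∀ i : ZMod q, i + 4 ≠ i := by
    simpa using ZMod.add_natCast_ne_self (q := q) (n := 4) (by simp) (by omega)
  have hpp' : p ≠ p' + 1 := fun h => C.valid (hc.2.2 p') (by rw [← h, hC])
  have hp'p : p' ≠ p + 1 := fun h => C.valid (hc.2.2 p) (by rw [← h, hC])
  have cover : ∀ x y : ZMod q, x ≠ y + 1 → degVec G d (c x) ≠ 0 →
      (∀ v, degVec G d v ≠ 0 → v = c x ∨ v = c (x + 1) ∨ v = c y ∨ v = c (y + 1)) →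
      d (cycEdge hc x) ≠ 0 ∨ (x = y + 2 ∧ d (cycEdge hc (y + 1)) ≠ 0) := by
    intro x y hxy hx hsub
    obtain ⟨e, he, hxe⟩ := exists_mem_of_degVec_apply_ne_zero hx
    obtain ⟨s, rfl⟩ := hcyc e he
    rcases (mem_cycEdge_iff hc).1 hxe with rfl | rfl
    · exact Or.inl he
    · have hs := hsub (c s) (degVec_apply_ne_zero he ((mem_cycEdge_iff hc).2 (Or.inl rfl)))
      simp only [hc.2.1.eq_iff] at hs
      rcases hs with hs | hs | hs | hs
      · exact absurd hs.symm (h1 s)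
      · exact absurd (by linear_combination -hs) (h2 s)
      · exact absurd (by rw [hs]) hxy
      · exact Or.inr ⟨by rw [hs]; ring, hs ▸ he⟩
  have share : ∀ x y : ZMod q, y = x + 2 →
      degVec G d = edgeVec (cycEdge hc x).1 + edgeVec (cycEdge hc y).1 →
      d (cycEdge hc x) ≠ 0 → d (cycEdge hc (x + 1)) = 0 := by
    intro x y hy hd hx
    by_contra hx1
    have hle := degVec_apply_mono G (single_add_single_le
      (fun h => h1 x (cycEdge_injective hc h).symm) hx hx1) (c (x + 1))
    rw [map_add, degVec_single, degVec_single, hd] at hle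
    have e3 : x + 2 ≠ x + 1 := fun h => h1 (x + 1) (by linear_combination h)
    have e4 : x + 2 + 1 ≠ x + 1 := fun h => h2 (x + 1) (by linear_combination h)
    have e5 : x + 1 + 1 ≠ x + 1 := h1 (x + 1)
    subst hy
    simp [edgeVec_cycEdge, hc.2.1.eq_iff, (h1 x).symm, e3, e4, e5] at hle
  have hdp : degVec G d (c p) ≠ 0 := by simp [hd, edgeVec_cycEdge]
  have hdp' : degVec G d (c p') ≠ 0 := by simp [hd, edgeVec_cycEdge]
  have hd' := hd.trans (add_comm _ _)
  rcases cover p p' hpp' hdp hsub with hl | ⟨hr, hr'⟩ <;>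
    rcases cover p' p hp'p hdp' (fun v hv => by have := hsub v hv; tauto)
      with hl₂ | ⟨hr₂, hr₂'⟩
  · obtain ⟨u, hu⟩ := exists_add_of_le
      (single_add_single_le (fun h => hp (cycEdge_injective hc h)) hl hl₂)
    rw [hu, map_add, map_add, degVec_single, degVec_single, add_eq_left] at hd
    rw [hu, eq_zero_of_degVec_eq_zero hd, add_zero]
  · exact absurd (share p p' hr₂ hd hl) hr₂'
  · exact absurd (share p' p hr hd' hl₂) hr'
  · exact absurd (by linear_combination -hr₂ - hr) (h4 p)

/-- The exponent of the product of the edges `{c i, c (i + 1)}` with `c i` of colour `t`. -/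
noncomputable def alternateVec [NeZero q] {α : Type*} [DecidableEq α] (C : G.Coloring α) (t : α) :
    G.edgeSet →₀ ℕ :=
  ∑ i with C (c i) = t, Finsupp.single (cycEdge hc i) 1

variable [NeZero q] (C : G.Coloring (Fin 2)) (t : Fin 2)

lemma alternateVec_apply [DecidableEq G.edgeSet] (e : G.edgeSet) :
    alternateVec hc C t e = ∑ i with C (c i) = t, if cycEdge hc i = e then 1 else 0 := by
  simp [alternateVec, Finsupp.finsetSum_apply, Finsupp.single_apply]

lemma alternateVec_cycEdge (i : ZMod q) :
    alternateVec hc C t (cycEdge hc i) = if C (c i) = t then 1 else 0 := by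
  classical
  simp only [alternateVec_apply, (cycEdge_injective hc).eq_iff]
  simp

lemma exists_of_alternateVec_ne_zero {e : G.edgeSet} (he : alternateVec hc C t e ≠ 0) :
    ∃ i, e = cycEdge hc i ∧ C (c i) = t := by
  classical
  rw [alternateVec_apply] at he
  obtain ⟨i, hi, hne⟩ := Finset.exists_ne_zero_of_sum_ne_zero he
  simp only [Finset.mem_filter, Finset.mem_univ, true_and] at hi
  refine ⟨i, ?_, hi⟩
  by_contra h
  exact hne (if_neg fun h' => h h'.symm)

lemma degVec_alternateVec :
    degVec G (alternateVec hc C t) = ∑ i, Finsupp.single (c i) 1 := by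
  have hflip : ∀ i, C (c i) = t ↔ ¬ C (c (i + 1)) = t := by
    intro i
    have := C.valid (hc.2.2 i)
    omega
  rw [alternateVec, map_sum]
  simp only [degVec_single, edgeVec_cycEdge, Finset.sum_add_distrib]
  have hshift : ∑ i with C (c i) = t, Finsupp.single (c (i + 1)) 1
      = ∑ i with ¬ C (c i) = t, Finsupp.single (c i) (1 : ℕ) := by
    rw [Finset.filter_congr fun i _ => hflip i]
    simp only [Finset.sum_filter]
    exact Equiv.sum_comp (Equiv.addRight (1 : ZMod q))
      fun i => if ¬ C (c i) = t then Finsupp.single (c i) (1 : ℕ) else 0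
  rw [hshift, Finset.sum_filter_add_sum_filter_not]

end Cycle

theorem isChordal6_of_hasQuadraticGB {V : Type uv} {G : SimpleGraph V} (C : G.Coloring (Fin 2))
    {K : Type*} [Field K] (h : HasQuadraticGB (toricIdeal K G)) : IsChordal6 G := by
  intro q c hc hq
  by_contra hchord
  have : NeZero q := ⟨by omega⟩
  obtain ⟨m, S, hS, hquad⟩ := h
  have hne : ∀ t t', t ≠ t' → alternateVec hc C t ≠ alternateVec hc C t' := by
    intro t t' htt' h
    obtain ⟨i, hi⟩ : ∃ i, C (c i) = t := by
      by_cases h0 : C (c 0) = t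
      · exact ⟨0, h0⟩
      · have := C.valid (hc.2.2 0)
        exact ⟨0 + 1, by omega⟩
    have h' := DFunLike.congr_fun h (cycEdge hc i)
    simp [alternateVec_cycEdge, hi, htt'] at h'
  obtain ⟨t, ht⟩ : ∃ t, alternateVec hc C t ∈ leadingExponents m (toricIdeal K G) := by
    have hdeg := fun t t' => (degVec_alternateVec hc C t).trans (degVec_alternateVec hc C t').symm
    rcases le_total (m.toSyn (alternateVec hc C 0)) (m.toSyn (alternateVec hc C 1)) with hle | hle
    · exact ⟨1, mem_leadingExponents_of_degVec_eq (hdeg 1 0) (hne 1 0 (by simp)) hle⟩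
    · exact ⟨0, mem_leadingExponents_of_degVec_eq (hdeg 0 1) (hne 0 1 (by simp)) hle⟩
  obtain ⟨e, e', hle, u, ⟨f, hf, hu, -⟩, hule⟩ :=
    exists_quadratic_le_of_mem_leadingExponents hS hquad ht
  have he := hle e
  have he' := hle e'
  simp only [Finsupp.add_apply, Finsupp.single_eq_same] at he he'
  obtain ⟨p, rfl, hp⟩ := exists_of_alternateVec_ne_zero hc C t (e := e) (by omega)
  obtain ⟨p', rfl, hp'⟩ := exists_of_alternateVec_ne_zero hc C t (e := e') (by omega)
  have hpp' : p ≠ p' := by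
    rintro rfl
    simp [alternateVec_cycEdge, hp] at he
  obtain ⟨u', -, hne', hdeg⟩ := exists_ne_of_mem_toricIdeal K G hf hu
  obtain ⟨s, hs⟩ := exists_add_of_le hule
  refine hne' (add_right_cancel (b := s) ?_)
  rw [← hs]
  refine eq_of_degVec_eq_cycEdge_add_cycEdge hc C hq hchord hpp' (hp.trans hp'.symm) ?_
  rw [map_add, hdeg, ← map_add, ← hs, map_add, degVec_single, degVec_single]

/-- For a finite connected bipartite graph, every cycle of length `≥ 6` has a chord if
and only if `I_G` possesses a quadratic Gröbner basis. -/
theorem bipartite_chord_iff_quadGB {V : Type uv} [Fintype V] (K : Type*) [Field K]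
    (G : SimpleGraph V) (hG : G.Connected) (hbip : G.Colorable 2) :
    (∀ (q : ℕ) (c : ZMod q → V), IsCycleOn' G q c → 6 ≤ q → ∃ e, IsChord G q c e) ↔
      HasQuadraticGB (toricIdeal K G) := by
  classical
  obtain ⟨C⟩ := hbip
  refine ⟨fun hch => ?_, fun h => isChordal6_of_hasQuadraticGB C h⟩
  obtain ⟨r, hr, hrn, hlex⟩ := exists_isDoublyLexical C
  exact hasQuadraticGB_of_isGammaFree K C hr (hlex.isGammaFree hrn hch)
end

section
/- Let G be a finite connected simple graph and G′ a connected induced subgraph of G. If I_G is generated by quadratic binomials, then I_{G′} is generated by quadratic binomials. -/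
set_option linter.unusedVariables false

open MvPolynomial

universe uv

@[simp]
theorem edgeMon_mk {V : Type*} (K : Type*) [Field K] (a b : V) :
    edgeMon K s(a, b) = X a * X b := rfl

theorem edgeMon_ne_zero {V : Type*} (K : Type*) [Field K] (e : Sym2 V) : edgeMon K e ≠ 0 := by
  induction e with
  | _ a b => exact mul_ne_zero (X_ne_zero a) (X_ne_zero b)

theorem rename_edgeMon {V W : Type*} (K : Type*) [Field K] (f : V → W) (e : Sym2 V) :
    rename f (edgeMon K e) = edgeMon K (e.map f) := by
  induction e with
  | _ a b => simp

/-- A product of two variables is not in the toric ideal. -/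
theorem X_mul_X_notMem_toricIdeal {V : Type*} (K : Type*) [Field K] (G : SimpleGraph V)
    (e f : G.edgeSet) : (X e * X f : MvPolynomial G.edgeSet K) ∉ toricIdeal K G := by
  simp only [toricIdeal, RingHom.mem_ker, map_mul, aeval_X]
  exact mul_ne_zero (edgeMon_ne_zero K _) (edgeMon_ne_zero K _)

/-- The inclusion of the edges of an induced subgraph. -/
def inducedEdge {V : Type*} (G : SimpleGraph V) (s : Set V) :
    (G.induce s).edgeSet ↪ G.edgeSet :=
  (SimpleGraph.Embedding.induce s).mapEdgeSet

@[simp]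
theorem coe_inducedEdge {V : Type*} (G : SimpleGraph V) (s : Set V) (e : (G.induce s).edgeSet) :
    (inducedEdge G s e : Sym2 V) = (e : Sym2 s).map Subtype.val := rfl

theorem mk_mem_range_inducedEdge {V : Type*} (G : SimpleGraph V) (s : Set V) {a b : V}
    (h : s(a, b) ∈ G.edgeSet) (ha : a ∈ s) (hb : b ∈ s) :
    (⟨s(a, b), h⟩ : G.edgeSet) ∈ Set.range (inducedEdge G s) :=
  ⟨⟨s(⟨a, ha⟩, ⟨b, hb⟩), h⟩, rfl⟩

theorem killCompl_X_apply {σ τ : Type*} (K : Type*) [Field K] (f : σ ↪ τ) (i : σ) :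
    killCompl f.injective (X (f i) : MvPolynomial τ K) = X i := by
  rw [← rename_X (R := K) f i, killCompl_rename_app]

theorem killCompl_X_of_notMem {σ τ : Type*} (K : Type*) [Field K] (f : σ ↪ τ) {j : τ}
    (h : j ∉ Set.range f) : killCompl f.injective (X j : MvPolynomial τ K) = 0 := by
  simp [killCompl, h]

theorem killCompl_X_cases {σ τ : Type*} (K : Type*) [Field K] (f : σ ↪ τ) (j : τ) :
    killCompl f.injective (X j : MvPolynomial τ K) = 0 ∨
      ∃ i, killCompl f.injective (X j : MvPolynomial τ K) = X i := by
  by_cases h : j ∈ Set.range f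
  · obtain ⟨i, rfl⟩ := h
    exact .inr ⟨i, killCompl_X_apply K f i⟩
  · exact .inl (killCompl_X_of_notMem K f h)

theorem killCompl_X_mul_X_cases {σ τ : Type*} (K : Type*) [Field K] (f : σ ↪ τ) (j k : τ) :
    killCompl f.injective (X j * X k : MvPolynomial τ K) = 0 ∨
      ∃ a b, killCompl f.injective (X j * X k : MvPolynomial τ K) = X a * X b := by
  rw [map_mul]
  rcases killCompl_X_cases K f j with h | ⟨a, ha⟩
  · simp [h]
  rcases killCompl_X_cases K f k with h | ⟨b, hb⟩
  · simp [h]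
  exact .inr ⟨a, b, by rw [ha, hb]⟩

theorem killCompl_edgeMon {V : Type*} (K : Type*) [Field K] (G : SimpleGraph V) (s : Set V)
    (e : G.edgeSet) :
    killCompl (Function.Embedding.subtype (· ∈ s)).injective (edgeMon K e.1) =
      aeval (R := K) (fun e : (G.induce s).edgeSet => edgeMon K e.1)
        (killCompl (inducedEdge G s).injective (X e)) := by
  by_cases he : e ∈ Set.range (inducedEdge G s)
  · obtain ⟨e, rfl⟩ := he
    rw [killCompl_X_apply, aeval_X, coe_inducedEdge, ← rename_edgeMon]
    exact killCompl_rename_app _ _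
  · rw [killCompl_X_of_notMem K _ he, map_zero]
    obtain ⟨e, h⟩ := e
    induction e with
    | _ a b =>
      rw [edgeMon_mk, map_mul, mul_eq_zero]
      by_cases ha : a ∈ s
      · exact .inr <| killCompl_X_of_notMem K _ fun ⟨b', hb⟩ =>
          he (mk_mem_range_inducedEdge G s h ha (hb ▸ b'.2))
      · exact .inl <| killCompl_X_of_notMem K _ fun ⟨a', h⟩ => ha (h ▸ a'.2)

theorem killCompl_mem_toricIdeal {V : Type*} (K : Type*) [Field K] (G : SimpleGraph V)
    (s : Set V) {p : MvPolynomial G.edgeSet K} (hp : p ∈ toricIdeal K G) :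
    killCompl (inducedEdge G s).injective p ∈ toricIdeal K (G.induce s) := by
  have key : (killCompl (Function.Embedding.subtype (· ∈ s)).injective).comp
        (aeval (R := K) fun e : G.edgeSet => edgeMon K e.1) =
      (aeval (R := K) fun e : (G.induce s).edgeSet => edgeMon K e.1).comp
        (killCompl (inducedEdge G s).injective) := by
    ext1 e
    simpa using killCompl_edgeMon K G s e
  have := DFunLike.congr_fun key p
  rw [toricIdeal, RingHom.mem_ker] at hp ⊢
  rw [AlgHom.comp_apply, AlgHom.comp_apply, hp, map_zero] at this
  exact this.symm

theorem rename_mem_toricIdeal {V : Type*} (K : Type*) [Field K] (G : SimpleGraph V)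
    (s : Set V) {p : MvPolynomial (G.induce s).edgeSet K}
    (hp : p ∈ toricIdeal K (G.induce s)) :
    rename (inducedEdge G s) p ∈ toricIdeal K G := by
  have key : (aeval (R := K) fun e : G.edgeSet => edgeMon K e.1).comp
        (rename (inducedEdge G s)) =
      (rename Subtype.val).comp
        (aeval (R := K) fun e : (G.induce s).edgeSet => edgeMon K e.1) := by
    ext1 e
    simp [rename_edgeMon]
  have := DFunLike.congr_fun key p
  rw [toricIdeal, RingHom.mem_ker] at hp ⊢
  rwa [AlgHom.comp_apply, AlgHom.comp_apply, hp, map_zero] at this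

/-- If `I_G` is generated by quadratic binomials, then so is the toric ideal of any
connected induced subgraph of `G`. -/
theorem quadGen_induce {V : Type*} [Fintype V] (K : Type*) [Field K]
    (G : SimpleGraph V) (hG : G.Connected) (s : Set V) (hG' : (G.induce s).Connected)
    (h : IsQuadBinomialGen (toricIdeal K G)) :
    IsQuadBinomialGen (toricIdeal K (G.induce s)) := by
  obtain ⟨S, hS, hquad⟩ := h
  refine ⟨{f | f ∈ toricIdeal K (G.induce s) ∧ ∃ i j k l, f = X i * X j - X k * X l},
    le_antisymm (fun p hp => ?_) (Ideal.span_le.2 fun f hf => hf.1), fun f hf => hf.2⟩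
  have hle : toricIdeal K G ≤ (Ideal.span {f | f ∈ toricIdeal K (G.induce s) ∧
      ∃ i j k l, f = X i * X j - X k * X l}).comap (killCompl (inducedEdge G s).injective) := by
    rw [hS, Ideal.span_le]
    intro f hf
    have hmem := killCompl_mem_toricIdeal K G s (hS ▸ Ideal.subset_span hf)
    obtain ⟨i, j, k, l, rfl⟩ := hquad f hf
    rw [SetLike.mem_coe, Ideal.mem_comap]
    rw [map_sub] at hmem ⊢
    rcases killCompl_X_mul_X_cases K (inducedEdge G s) i j with h₁ | ⟨a, b, h₁⟩ <;>
      rcases killCompl_X_mul_X_cases K (inducedEdge G s) k l with h₂ | ⟨c, d, h₂⟩ <;>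
      rw [h₁, h₂] at hmem ⊢
    · simp
    · rw [zero_sub, neg_mem_iff] at hmem
      exact absurd hmem (X_mul_X_notMem_toricIdeal K _ c d)
    · rw [sub_zero] at hmem
      exact absurd hmem (X_mul_X_notMem_toricIdeal K _ a b)
    · exact Ideal.subset_span ⟨hmem, a, b, c, d, rfl⟩
  have := hle (rename_mem_toricIdeal K G s hp)
  rwa [Ideal.mem_comap, killCompl_rename_app] at this
end

section
/- Let G be a finite connected simple graph. If G is co-chordal, then every cycle of G of length ≥ 5 has a chord. -/
set_option linter.unusedVariables false

universe uv

/-- A graph is chordal if every cycle of length `> 3` has a chord. -/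
def Chordal {V : Type*} (H : SimpleGraph V) : Prop :=
  ∀ (q : ℕ) (c : ZMod q → V), IsCycleOn' H q c → 3 < q → ∃ e, IsChord H q c e

/-- A graph is co-chordal if its complement is chordal. -/
def CoChordal {V : Type*} (G : SimpleGraph V) : Prop := Chordal Gᶜ

theorem adj_cycle_iff_of_no_chord {V : Type*} {G : SimpleGraph V} {q : ℕ} {c : ZMod q → V}
    (hc : IsCycleOn' G q c) (hno : ¬ ∃ e, IsChord G q c e) (i j : ZMod q) :
    G.Adj (c i) (c j) ↔ j = i + 1 ∨ i = j + 1 := by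
  refine ⟨fun hadj => ?_, ?_⟩
  · by_contra hne
    refine hno ⟨s(c i, c j), hadj, ?_, i, j, rfl⟩
    rintro ⟨k, hk⟩
    rcases Sym2.eq_iff.1 hk with ⟨h₁, h₂⟩ | ⟨h₁, h₂⟩
    · exact hne (Or.inl (by rw [hc.2.1 h₁, hc.2.1 h₂]))
    · exact hne (Or.inr (by rw [hc.2.1 h₁, hc.2.1 h₂]))
  · rintro (rfl | rfl)
    · exact hc.2.2 i
    · exact (hc.2.2 j).symm

/-- The complement of a chordless 5-cycle is again a chordless 5-cycle. -/
theorem not_coChordal_of_chordless_five_cycle {V : Type*} {G : SimpleGraph V} {c : ZMod 5 → V}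
    (hc : IsCycleOn' G 5 c) (hno : ¬ ∃ e, IsChord G 5 c e) : ¬ CoChordal G := by
  have key := adj_cycle_iff_of_no_chord hc hno
  intro h
  have hcycle : IsCycleOn' Gᶜ 5 (fun i => c (2 * i)) := by
    refine ⟨by norm_num, ?_, fun i => ?_⟩
    · have hinj : Function.Injective (fun i : ZMod 5 => 2 * i) := by decide
      exact hc.2.1.comp hinj
    · rw [SimpleGraph.compl_adj, key, hc.2.1.ne_iff]
      revert i
      decide
  obtain ⟨e, he, hne, i, j, rfl⟩ := h 5 _ hcycle (by norm_num)
  have hij : ¬ (2 * j = 2 * i + 1 ∨ 2 * i = 2 * j + 1) := by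
    rw [← key]
    exact ((SimpleGraph.compl_adj _ _ _).1 he).2
  have hij' : i ≠ j := by
    rintro rfl
    exact Gᶜ.irrefl he
  have hcases : ∀ i j : ZMod 5, i ≠ j → ¬ (2 * j = 2 * i + 1 ∨ 2 * i = 2 * j + 1) →
      j = i + 1 ∨ i = j + 1 := by decide
  rcases hcases i j hij' hij with rfl | rfl
  · exact hne ⟨i, rfl⟩
  · exact hne ⟨j, Sym2.eq_swap⟩

/-- The positions `0, 3, 1, 4`, in the order in which the vertices there form a 4-cycle in the
complement of a chordless cycle of length at least 6. -/
def fourVertices (i : ZMod 4) : ℕ := (![0, 3, 1, 4] : Fin 4 → ℕ) i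

/-- Two disjoint nonadjacent edges of a chordless cycle of length at least 6 form a chordless
4-cycle in the complement. -/
theorem not_coChordal_of_chordless_cycle {V : Type*} {G : SimpleGraph V} {q : ℕ}
    {c : ZMod q → V} (hc : IsCycleOn' G q c) (hno : ¬ ∃ e, IsChord G q c e) (hq : 6 ≤ q) :
    ¬ CoChordal G := by
  have key := adj_cycle_iff_of_no_chord hc hno
  have hcast : ∀ a b : ℕ, a < 6 → b < 6 → ((a : ZMod q) = b ↔ a = b) := by
    intro a b ha hb
    rw [ZMod.natCast_eq_natCast_iff', Nat.mod_eq_of_lt (ha.trans_le hq),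
      Nat.mod_eq_of_lt (hb.trans_le hq)]
  have hadj : ∀ a b : ℕ, a < 5 → b < 5 →
      (G.Adj (c a) (c b) ↔ b = a + 1 ∨ a = b + 1) := by
    intro a b ha hb
    rw [key, ← hcast b (a + 1) (by lia) (by lia), ← hcast a (b + 1) (by lia) (by lia)]
    push_cast
    rfl
  have hlt : ∀ i : ZMod 4, fourVertices i < 5 := by decide
  have hinj : ∀ a b : ℕ, a < 5 → b < 5 → (c a = c b ↔ a = b) := fun a b ha hb => by
    rw [hc.2.1.eq_iff, hcast a b (by lia) (by lia)]
  intro h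
  have hcycle : IsCycleOn' Gᶜ 4 (fun i => c (fourVertices i)) := by
    refine ⟨by norm_num, fun i j hij => ?_, fun i => ?_⟩
    · have hfour : Function.Injective fourVertices := by decide
      exact hfour ((hinj _ _ (hlt i) (hlt j)).1 hij)
    · rw [SimpleGraph.compl_adj, hadj _ _ (hlt i) (hlt _), ne_eq, hinj _ _ (hlt i) (hlt _)]
      revert i
      decide
  obtain ⟨e, he, hne, i, j, rfl⟩ := h 4 _ hcycle (by norm_num)
  have hij := (SimpleGraph.compl_adj _ _ _).1 he
  rw [hadj _ _ (hlt i) (hlt j), ne_eq, hinj _ _ (hlt i) (hlt j)] at hij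
  have hcases : ∀ i j : ZMod 4,
      (¬ fourVertices i = fourVertices j ∧
        ¬ (fourVertices j = fourVertices i + 1 ∨ fourVertices i = fourVertices j + 1)) →
      j = i + 1 ∨ i = j + 1 := by decide
  rcases hcases i j hij with rfl | rfl
  · exact hne ⟨i, rfl⟩
  · exact hne ⟨j, Sym2.eq_swap⟩

/-- If a finite connected graph is co-chordal, then every cycle of length `≥ 5`
has a chord. -/
theorem coChordal_chord {V : Type*} [Fintype V] (G : SimpleGraph V) (hG : G.Connected)
    (h : CoChordal G) :
    ∀ (q : ℕ) (c : ZMod q → V), IsCycleOn' G q c → 5 ≤ q → ∃ e, IsChord G q c e := by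
  intro q c hc hq
  by_contra hno
  rcases hq.eq_or_lt with rfl | hq
  · exact not_coChordal_of_chordless_five_cycle hc hno h
  · exact not_coChordal_of_chordless_cycle hc hno hq h
end
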